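/- Assume Hypothesis (B): every involution on A₁ is conjugate to α. Let f be an endomorphism of A₁ and suppose there exist involutions γ and δ on A₁ such that f ∘ γ = δ ∘ f. Then f is an automorphism of A₁. -/

import Mathlib

noncomputable section

/-- `f : A → A` is a `K`-algebra endomorphism (as a bare function). -/
def IsAlgEndo (K : Type) [CommSemiring K] {A : Type} [Semiring A] [Algebra K A]
    (f : A → A) : Prop :=
  (∀ a b : A, f (a + b) = f a + f b) ∧
  (∀ (c : K) (a : A), f (c • a) = c • f a) ∧
  (∀ a b : A, f (a * b) = f a * f b) ∧ f 1 = 1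

/-- `f : A → A` is a `K`-algebra automorphism: a bijective endomorphism. -/
def IsAlgAuto (K : Type) [CommSemiring K] {A : Type} [Semiring A] [Algebra K A]
    (f : A → A) : Prop :=
  IsAlgEndo K f ∧ Function.Bijective f

/-- `f : A → A` is a `K`-linear anti-endomorphism. -/
def IsAntiEndo (K : Type) [CommSemiring K] {A : Type} [Semiring A] [Algebra K A]
    (f : A → A) : Prop :=
  (∀ a b : A, f (a + b) = f a + f b) ∧
  (∀ (c : K) (a : A), f (c • a) = c • f a) ∧
  (∀ a b : A, f (a * b) = f b * f a) ∧ f 1 = 1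

/-- `f : A → A` is an anti-automorphism: a bijective anti-endomorphism. -/
def IsAntiAuto (K : Type) [CommSemiring K] {A : Type} [Semiring A] [Algebra K A]
    (f : A → A) : Prop :=
  IsAntiEndo K f ∧ Function.Bijective f

/-- An involution on a `K`-algebra: an anti-automorphism of order at most two. -/
def IsInvolutionOn (K : Type) [CommSemiring K] {A : Type} [Semiring A] [Algebra K A]
    (γ : A → A) : Prop :=
  IsAntiAuto K γ ∧ γ ∘ γ = id

/-- The defining relation of the first Weyl algebra: `Y*X = X*Y + 1`. -/
inductive WeylRel (K : Type) [CommSemiring K] :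
    FreeAlgebra K (Fin 2) → FreeAlgebra K (Fin 2) → Prop
  | rel : WeylRel K (FreeAlgebra.ι K 1 * FreeAlgebra.ι K 0)
      (FreeAlgebra.ι K 0 * FreeAlgebra.ι K 1 + 1)

/-- The first Weyl algebra `A₁(K) = K⟨X,Y⟩/(YX - XY - 1)`. -/
abbrev Weyl (K : Type) [CommSemiring K] : Type := RingQuot (WeylRel K)

/-- The generator `X` of the Weyl algebra. -/
def Wx (K : Type) [CommSemiring K] : Weyl K :=
  RingQuot.mkAlgHom K (WeylRel K) (FreeAlgebra.ι K 0)

/-- The generator `Y` of the Weyl algebra. -/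
def Wy (K : Type) [CommSemiring K] : Weyl K :=
  RingQuot.mkAlgHom K (WeylRel K) (FreeAlgebra.ι K 1)

/-- `α` is the exchange involution: the involution with `α X = Y` and `α Y = X`. -/
def IsExchange (K : Type) [CommSemiring K] (α : Weyl K → Weyl K) : Prop :=
  IsInvolutionOn K α ∧ α (Wx K) = Wy K ∧ α (Wy K) = Wx K

/-- `γ` is conjugate to `α` by an automorphism or an anti-automorphism:
`γ = g⁻¹ ∘ α ∘ g`. -/
def ConjToAlpha (K : Type) [CommSemiring K] (α γ : Weyl K → Weyl K) : Prop :=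
  ∃ g : Weyl K → Weyl K, (IsAlgAuto K g ∨ IsAntiAuto K g) ∧
    γ = Function.invFun g ∘ α ∘ g


section WeylBasics
open Polynomial
variable (R : Type) [CommRing R]

theorem wy_wx : Wy R * Wx R = Wx R * Wy R + 1 := by
  have := RingQuot.mkAlgHom_rel R (WeylRel.rel (K := R))
  simpa [Wx, Wy] using this

variable {R}

def wLift {A : Type} [Ring A] [Algebra R A]
    (x y : A) (h : y * x = x * y + 1) : Weyl R →ₐ[R] A :=
  RingQuot.liftAlgHom R ⟨FreeAlgebra.lift R ![x, y], by
    rintro _ _ ⟨⟩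
    simpa using h⟩

@[simp] theorem wLift_x {A : Type} [Ring A] [Algebra R A]
    (x y : A) (h : y * x = x * y + 1) : wLift x y h (Wx R) = x := by
  simp [wLift, Wx]

@[simp] theorem wLift_y {A : Type} [Ring A] [Algebra R A]
    (x y : A) (h : y * x = x * y + 1) : wLift x y h (Wy R) = y := by
  simp [wLift, Wy]

theorem w_hom_ext {A : Type} [Ring A] [Algebra R A] {f g : Weyl R →ₐ[R] A}
    (hx : f (Wx R) = g (Wx R)) (hy : f (Wy R) = g (Wy R)) : f = g := by
  apply RingQuot.ringQuot_ext'
  apply FreeAlgebra.hom_ext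
  funext i
  fin_cases i
  · exact hx
  · exact hy

theorem w_adjoin (P : Subalgebra R (Weyl R)) (hx : Wx R ∈ P) (hy : Wy R ∈ P) (a : Weyl R) : a ∈ P := by
  obtain ⟨b, rfl⟩ := RingQuot.mkAlgHom_surjective R (WeylRel R) a
  have : b ∈ P.comap (RingQuot.mkAlgHom R (WeylRel R)) := by
    have h : (⊤ : Subalgebra R (FreeAlgebra R (Fin 2))) ≤ P.comap (RingQuot.mkAlgHom R (WeylRel R)) := by
      rw [← FreeAlgebra.adjoin_range_ι, Algebra.adjoin_le_iff]
      rintro _ ⟨i, rfl⟩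
      fin_cases i
      · exact hx
      · exact hy
    exact h trivial
  exact this

/-- general commutation -/
theorem comm_pow {A : Type} [Ring A] {x y : A} (h : y * x = x * y + 1) (n : ℕ) :
    y * x ^ n = x ^ n * y + n * x ^ (n - 1) := by
  induction n with
  | zero => simp
  | succ n ih =>
    rw [pow_succ, ← mul_assoc, ih, add_mul, mul_assoc, h]
    rcases n with _ | n
    · simp
    · simp only [Nat.add_sub_cancel, mul_add, mul_one, mul_assoc, ← pow_succ]
      push_cast
      noncomm_ring

theorem comm_pow' {A : Type} [Ring A] {x y : A} (h : y * x = x * y + 1) (n : ℕ) :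
    y ^ n * x = x * y ^ n + n * y ^ (n - 1) := by
  induction n with
  | zero => simp
  | succ n ih =>
    rw [pow_succ', mul_assoc, ih, mul_add, ← mul_assoc, h]
    rcases n with _ | n
    · simp
    · have := (Nat.cast_commute (n+1) y).eq
      simp only [Nat.add_sub_cancel, pow_succ', mul_assoc, add_mul, one_mul]
      rw [← mul_assoc y (((n+1 : ℕ) : A)), ← this]
      push_cast
      noncomm_ring

theorem neg_rel {A : Type} [Ring A] {x y : A} (h : y * x = x * y + 1) :
    x * (-y) = (-y) * x + 1 := by
  rw [neg_mul, h]; noncomm_ring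

variable (R) in
def mon (m : ℕ × ℕ) : Weyl R := Wx R ^ m.1 * Wy R ^ m.2

theorem mon_mem (a : Weyl R) : a ∈ Submodule.span R (Set.range (mon R)) := by
  set M := Submodule.span R (Set.range (mon R)) with hM
  have key : ∀ c : Weyl R, (∀ m, c * mon R m ∈ M) → ∀ b ∈ M, c * b ∈ M := by
    intro c hc b hb
    induction hb using Submodule.span_induction with
    | mem x h => obtain ⟨m, rfl⟩ := h; exact hc m
    | zero => simp
    | add x y _ _ hx hy => rw [mul_add]; exact M.add_mem hx hy
    | smul r x _ hx => rw [mul_smul_comm]; exact M.smul_mem _ hx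
  let P : Subalgebra R (Weyl R) :=
    { carrier := {a | ∀ b ∈ M, a * b ∈ M}
      mul_mem' := by
        intro a b ha hb c hc
        rw [mul_assoc]; exact ha _ (hb _ hc)
      add_mem' := by
        intro a b ha hb c hc
        rw [add_mul]; exact M.add_mem (ha _ hc) (hb _ hc)
      algebraMap_mem' := by
        intro r b hb
        rw [← Algebra.smul_def]; exact M.smul_mem _ hb }
  have hmon : ∀ m, mon R m ∈ M := fun m => Submodule.subset_span ⟨m, rfl⟩
  have h1 : a ∈ P := by
    apply w_adjoin
    · apply key
      rintro ⟨i, j⟩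
      have : Wx R * mon R (i, j) = mon R (i+1, j) := by simp [mon, pow_succ', mul_assoc]
      rw [this]; exact hmon _
    · apply key
      rintro ⟨i, j⟩
      have : Wy R * mon R (i, j) = mon R (i, j+1) + (i : R) • mon R (i-1, j) := by
        simp only [mon]
        rw [← mul_assoc, comm_pow (wy_wx R), add_mul, mul_assoc, ← pow_succ', Algebra.smul_def]
        simp [mul_assoc]
      rw [this]; exact M.add_mem (hmon _) (M.smul_mem _ (hmon _))
  have := h1 (mon R (0,0)) (hmon _)
  simpa [mon] using this

variable (R) in
def wRep : Weyl R →ₐ[R] Module.End R R[X][X] :=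
  wLift (LinearMap.mulLeft R X) ((derivative (R := R[X])).restrictScalars R + LinearMap.mulLeft R (C X)) (by
    ext f : 1
    simp
    ring)

theorem wRep_x (g : R[X][X]) : wRep R (Wx R) g = X * g := by simp [wRep]
theorem wRep_y (g : R[X][X]) : wRep R (Wy R) g = derivative g + C X * g := by simp [wRep]

def wSym (a : Weyl R) : R[X][X] := wRep R a 1

theorem wSym_mul (a b : Weyl R) : wSym (a * b) = wRep R a (wSym b) := by
  simp [wSym]

theorem wRep_mon (m : ℕ × ℕ) : wSym (mon R m) = C (X ^ m.2) * X ^ m.1 := by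
  have hy : ∀ j, wRep R (Wy R ^ j) 1 = C (X ^ j) := by
    intro j
    induction j with
    | zero => simp
    | succ j ih => rw [pow_succ', map_mul, Module.End.mul_apply, ih, wRep_y, derivative_C, zero_add, pow_succ', C_mul]
  have hx : ∀ i g, wRep R (Wx R ^ i) g = X ^ i * g := by
    intro i g
    induction i with
    | zero => simp
    | succ j ih => rw [pow_succ', map_mul, Module.End.mul_apply, ih, wRep_x]; ring
  rw [wSym, mon, map_mul, Module.End.mul_apply, hy, hx, mul_comm]

/-- coefficient functional -/
def cf (m : ℕ × ℕ) : Weyl R →ₗ[R] R where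
  toFun a := ((wSym a).coeff m.1).coeff m.2
  map_add' a b := by simp [wSym]
  map_smul' r a := by simp [wSym]

theorem cf_mon (m n : ℕ × ℕ) : cf m (mon R n) = if m = n then 1 else 0 := by
  show ((wSym (mon R n)).coeff m.1).coeff m.2 = _
  rw [wRep_mon]
  rcases m with ⟨a, b⟩
  rcases n with ⟨c, d⟩
  simp only [coeff_C_mul, coeff_X_pow, Prod.mk.injEq]
  split_ifs <;> simp_all [coeff_X_pow]

theorem w_repr (a : Weyl R) : ∃ F : Finset (ℕ × ℕ), (∀ m, m ∉ F → cf m a = 0) ∧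
    a = ∑ m ∈ F, cf m a • mon R m := by
  obtain ⟨c, hc⟩ := Finsupp.mem_span_range_iff_exists_finsupp.1 (mon_mem a)
  have h : ∀ m, cf m a = c m := by
    intro m
    rw [← hc, Finsupp.sum, map_sum]
    simp [cf_mon]
  refine ⟨c.support, fun m hm => ?_, ?_⟩
  · rw [h]; simpa using hm
  · conv_lhs => rw [← hc]
    simp [Finsupp.sum, h]

theorem w_repr' (a : Weyl R) (F : Finset (ℕ × ℕ)) (h : ∀ m, m ∉ F → cf m a = 0) :
    a = ∑ m ∈ F, cf m a • mon R m := by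
  obtain ⟨G, hG, e⟩ := w_repr a
  conv_lhs => rw [e]
  have h1 : ∑ m ∈ G, cf m a • mon R m = ∑ m ∈ G ∪ F, cf m a • mon R m := by
    apply Finset.sum_subset Finset.subset_union_left
    intro m _ hm; rw [hG m hm, zero_smul]
  have h2 : ∑ m ∈ F, cf m a • mon R m = ∑ m ∈ G ∪ F, cf m a • mon R m := by
    apply Finset.sum_subset Finset.subset_union_right
    intro m _ hm; rw [h m hm, zero_smul]
  rw [h1, h2]

theorem w_ext {a b : Weyl R} (h : ∀ m, cf m a = cf m b) : a = b := by
  rw [← sub_eq_zero]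
  obtain ⟨F, _, e⟩ := w_repr (a - b)
  rw [e]; apply Finset.sum_eq_zero
  intro m _; simp [h]

theorem w_lin_ind {M : Type} [AddCommGroup M] [Module R M] {f g : Weyl R →ₗ[R] M}
    (h : ∀ m, f (mon R m) = g (mon R m)) (a : Weyl R) : f a = g a := by
  obtain ⟨F, _, e⟩ := w_repr a
  rw [e]; simp [h]

theorem cf_ady (a : Weyl R) (m : ℕ × ℕ) :
    cf m (Wy R * a - a * Wy R) = (m.1 + 1) * cf (m.1 + 1, m.2) a := by
  refine w_lin_ind (f := (cf m).comp (LinearMap.mulLeft R (Wy R) - LinearMap.mulRight R (Wy R)))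
    (g := ((m.1 + 1 : R)) • cf (m.1+1, m.2)) ?_ a
  rintro ⟨i, j⟩
  have : Wy R * mon R (i, j) - mon R (i, j) * Wy R = (i : R) • mon R (i-1, j) := by
    simp only [mon]
    rw [← mul_assoc, comm_pow (wy_wx R), add_mul, mul_assoc, mul_assoc, ← pow_succ', mul_assoc, ← pow_succ, Algebra.smul_def]
    simp [mul_assoc]
  simp only [LinearMap.comp_apply, LinearMap.sub_apply, LinearMap.mulLeft_apply, LinearMap.mulRight_apply, this,
    map_smul, LinearMap.smul_apply, cf_mon, smul_eq_mul]
  rcases m with ⟨a, b⟩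
  rcases i with _ | i
  · simp
  · simp only [Nat.add_sub_cancel, Prod.mk.injEq, add_left_inj]
    split_ifs with h
    · rw [h.1]; push_cast; ring
    · simp

theorem cf_adx (a : Weyl R) (m : ℕ × ℕ) :
    cf m (a * Wx R - Wx R * a) = (m.2 + 1) * cf (m.1, m.2 + 1) a := by
  refine w_lin_ind (f := (cf m).comp (LinearMap.mulRight R (Wx R) - LinearMap.mulLeft R (Wx R)))
    (g := ((m.2 + 1 : R)) • cf (m.1, m.2+1)) ?_ a
  rintro ⟨i, j⟩
  have h2 := comm_pow' (wy_wx R) j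
  have : mon R (i, j) * Wx R - Wx R * mon R (i, j) = (j : R) • mon R (i, j-1) := by
    simp only [mon]
    rw [mul_assoc, h2, Algebra.smul_def, mul_add, ← mul_assoc, ← pow_succ, ← mul_assoc, ← mul_assoc, ← pow_succ']
    simp only [map_natCast, add_sub_cancel_left]
    rw [← (Nat.cast_commute j (Wx R ^ i)).eq, mul_assoc]
  simp only [LinearMap.comp_apply, LinearMap.sub_apply, LinearMap.mulLeft_apply, LinearMap.mulRight_apply, this,
    map_smul, LinearMap.smul_apply, cf_mon, smul_eq_mul]
  rcases m with ⟨a, b⟩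
  rcases j with _ | j
  · simp
  · simp only [Nat.add_sub_cancel, Prod.mk.injEq, add_left_inj]
    split_ifs with h
    · rw [h.2]; push_cast; ring
    · simp

variable (R) in
def wMap (R' : Type) [CommRing R'] [Algebra R R'] : Weyl R →ₐ[R] Weyl R' :=
  wLift (Wx R') (Wy R') (wy_wx R')

theorem wMap_mon {R' : Type} [CommRing R'] [Algebra R R'] (m) : wMap R R' (mon R m) = mon R' m := by
  simp [wMap, mon]

theorem cf_map {R' : Type} [CommRing R'] [Algebra R R'] (m) (a : Weyl R) :
    cf m (wMap R R' a) = algebraMap R R' (cf m a) := by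
  obtain ⟨F, _, e⟩ := w_repr a
  rw [e]
  simp only [map_sum, map_smul, wMap_mon, cf_mon]
  apply Finset.sum_congr rfl
  intro n _
  rw [← algebraMap_smul R' (cf n a) (mon R' n), map_smul, cf_mon]
  split_ifs <;> simp

variable (R) in
def wSig : Weyl R →ₐ[R] (Weyl R)ᵐᵒᵖ :=
  wLift (MulOpposite.op (Wx R)) (MulOpposite.op (-Wy R)) (by
    rw [← MulOpposite.op_mul, ← MulOpposite.op_mul, ← MulOpposite.op_one, ← MulOpposite.op_add]
    congr 1
    exact neg_rel (wy_wx R))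

end WeylBasics

section Indep

theorem ad_indep {A : Type} [Ring A] (I : AddSubgroup A) {S T : A} (h : T * S = S * T + 1)
    (hl : ∀ a x, x ∈ I → a * x ∈ I) (hr : ∀ a x, x ∈ I → x * a ∈ I) (n : ℕ)
    (hinv : ∀ i : ℕ, 0 < i → i < n → ∀ x, (i : A) * x ∈ I → x ∈ I)
    (c : ℕ → A) (hc : ∀ i, T * c i = c i * T)
    (hs : ∑ i ∈ Finset.range n, S ^ i * c i ∈ I) : ∀ i < n, c i ∈ I := by
  induction n generalizing c with
  | zero => intro i hi; omega
  | succ n ih =>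
    have h1 : ∑ i ∈ Finset.range n, S ^ i * ((i + 1 : ℕ) * c (i + 1)) ∈ I := by
      have h2 := I.sub_mem (hl T _ hs) (hr T _ hs)
      convert h2 using 1
      rw [Finset.mul_sum, Finset.sum_mul, ← Finset.sum_sub_distrib, Finset.sum_range_succ']
      have : T * (S ^ 0 * c 0) - S ^ 0 * c 0 * T = 0 := by simp [hc]
      rw [this, add_zero]
      apply Finset.sum_congr rfl
      intro i _
      rw [← mul_assoc T, comm_pow h, Nat.add_sub_cancel, add_mul, mul_assoc _ T, hc, ← mul_assoc,
        ← mul_assoc (S ^ (i+1)), add_sub_cancel_left, (Nat.cast_commute (i+1) (S^i)).eq]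
    have h3 : ∀ i < n, c (i+1) ∈ I := by
      intro i hi
      apply hinv (i+1) (by omega) (by omega)
      refine ih (fun i h0 hi => hinv i h0 (by omega)) (fun i => ((i + 1 : ℕ) * c (i + 1))) ?_ h1 i hi
      intro i
      rw [← mul_assoc, ← (Nat.cast_commute (i+1) T).eq, mul_assoc, hc, mul_assoc]
    intro i hi
    rcases i with _ | i
    · rw [Finset.sum_range_succ'] at hs
      have : ∑ i ∈ Finset.range n, S ^ (i+1) * c (i+1) ∈ I :=
        I.sum_mem fun i hi => hl _ _ (h3 i (Finset.mem_range.1 hi))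
      have := I.sub_mem hs this
      simpa using this
    · exact h3 i (by omega)

theorem ad_indep2 {A : Type} [Ring A] (I : AddSubgroup A) {S T : A} (h : T * S = S * T + 1)
    (hl : ∀ a x, x ∈ I → a * x ∈ I) (hr : ∀ a x, x ∈ I → x * a ∈ I) (n : ℕ)
    (hinv : ∀ i : ℕ, 0 < i → i < n → ∀ x, (i : A) * x ∈ I → x ∈ I)
    (z : ℕ → ℕ → A) (hz : ∀ i j a, a * z i j = z i j * a)
    (hs : ∑ i ∈ Finset.range n, ∑ j ∈ Finset.range n, z i j * (S ^ i * T ^ j) ∈ I) :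
    ∀ i < n, ∀ j < n, z i j ∈ I := by
  have h1 : ∀ i < n, ∑ j ∈ Finset.range n, T ^ j * z i j ∈ I := by
    apply ad_indep I h hl hr n hinv
    · intro i
      rw [Finset.mul_sum, Finset.sum_mul]
      apply Finset.sum_congr rfl
      intro j _
      rw [← mul_assoc, ← pow_succ', mul_assoc, ← hz, ← mul_assoc, ← pow_succ]
    · convert hs using 1
      apply Finset.sum_congr rfl
      intro i _
      rw [Finset.mul_sum]
      apply Finset.sum_congr rfl
      intro j _
      rw [← hz, mul_assoc]
  intro i hi
  have h2 : (-S) * T = T * (-S) + 1 := by rw [mul_neg, h]; noncomm_ring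
  exact ad_indep I h2 hl hr n hinv (z i) (fun j => hz i j _) (h1 i hi)

theorem natcast_inv {A : Type} [Ring A] {p : ℕ} [hp : Fact p.Prime] [CharP A p] (I : AddSubgroup A)
    (hl : ∀ a x, x ∈ I → a * x ∈ I) : ∀ i : ℕ, 0 < i → i < p → ∀ x, (i : A) * x ∈ I → x ∈ I := by
  intro i h0 hi x hx
  have : IsUnit (i : A) := by
    rw [CharP.isUnit_natCast_iff (p := p) hp.out]
    exact Nat.not_dvd_of_pos_of_lt h0 hi
  obtain ⟨u, hu⟩ := this
  have := hl (↑u⁻¹ : A) _ hx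
  rwa [← hu, ← mul_assoc, Units.inv_mul, one_mul] at this

/-- Main centrality lemma, abstractly. -/
theorem pow_central {A : Type} [Ring A] {p : ℕ} [hp : Fact p.Prime] [CharP A p] {x y : A}
    (hxy : y * x = x * y + 1)
    (hspan : Submodule.span (Subring.center A)
      (Set.range (fun m : Fin p × Fin p => x ^ (m.1 : ℕ) * y ^ (m.2 : ℕ))) = ⊤)
    {S T : A} (h : T * S = S * T + 1) : S ^ p ∈ Subring.center A := by
  classical
  let Z := Subring.center A
  have hp0 : 0 < p := hp.out.pos
  have hcomm : ∀ (z : Z) (a : A), a * (z : A) = z * a := fun z a =>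
    (Subring.mem_center_iff.1 z.2 a)
  -- sums over Fin p x Fin p
  have hsum : ∀ (S T : A) (w : Fin p × Fin p → Z),
      ∑ m, w m • (S ^ (m.1 : ℕ) * T ^ (m.2 : ℕ)) =
      ∑ i ∈ Finset.range p, ∑ j ∈ Finset.range p,
        ((if hi : i < p ∧ j < p then w (⟨i, hi.1⟩, ⟨j, hi.2⟩) else 0 : Z) : A) * (S ^ i * T ^ j) := by
    intro S T w
    rw [Fintype.sum_prod_type, ← Fin.sum_univ_eq_sum_range
      (fun i => ∑ j ∈ Finset.range p, ((if hi : i < p ∧ j < p then w (⟨i, hi.1⟩, ⟨j, hi.2⟩) else 0 : Z) : A) * (S ^ i * T ^ j))]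
    apply Finset.sum_congr rfl
    intro i _
    rw [← Fin.sum_univ_eq_sum_range
      (fun j => ((if hi : (i : ℕ) < p ∧ j < p then w (⟨i, hi.1⟩, ⟨j, hi.2⟩) else 0 : Z) : A) * (S ^ (i : ℕ) * T ^ j))]
    apply Finset.sum_congr rfl
    intro j _
    simp [Subring.smul_def]
  have hind : ∀ (I : AddSubgroup A) (hl : ∀ a x, x ∈ I → a * x ∈ I) (hr : ∀ a x, x ∈ I → x * a ∈ I)
      (S T : A) (h : T * S = S * T + 1) (w : Fin p × Fin p → Z),
      ∑ m, w m • (S ^ (m.1 : ℕ) * T ^ (m.2 : ℕ)) ∈ I → ∀ m, (w m : A) ∈ I := by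
    intro I hl hr S T h w hw m
    rw [hsum] at hw
    have := ad_indep2 I h hl hr p (natcast_inv I hl)
      (fun i j => ((if hi : i < p ∧ j < p then w (⟨i, hi.1⟩, ⟨j, hi.2⟩) else 0 : Z) : A))
      (fun i j a => hcomm _ a) hw m.1 m.1.2 m.2 m.2.2
    simpa using this
  have hli : LinearIndependent Z (fun m : Fin p × Fin p => x ^ (m.1 : ℕ) * y ^ (m.2 : ℕ)) := by
    rw [Fintype.linearIndependent_iff]
    intro w hw m
    have := hind ⊥ (by simp) (by simp) x y hxy w (by simpa using hw) m
    simpa using this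
  let e : Module.Basis (Fin p × Fin p) Z A := Module.Basis.mk hli hspan.ge
  let v : Fin p × Fin p → A := fun m => S ^ (m.1 : ℕ) * T ^ (m.2 : ℕ)
  have hunit : IsUnit (e.det v) := by
    by_contra hn
    obtain ⟨n, hmax, hmem⟩ := exists_max_ideal_of_mem_nonunits hn
    letI := Ideal.Quotient.field n
    have hd : ((e.toMatrix v).map (Ideal.Quotient.mk n)).det = 0 := by
      have := RingHom.map_det (Ideal.Quotient.mk n) (e.toMatrix v)
      rw [RingHom.mapMatrix_apply] at this
      rw [← this, ← Module.Basis.det_apply]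
      exact Ideal.Quotient.eq_zero_iff_mem.2 hmem
    obtain ⟨w', hw0, hw⟩ := Matrix.exists_mulVec_eq_zero_iff.2 hd
    choose w hww using fun m => Ideal.Quotient.mk_surjective (I := n) (w' m)
    let J : Submodule Z A := n • ⊤
    have hL : ∀ (f : A →ₗ[Z] A) (a : A), a ∈ J → f a ∈ J := by
      intro f a ha
      refine Submodule.smul_induction_on ha ?_ ?_
      · intro r hr b _
        rw [map_smul]; exact Submodule.smul_mem_smul hr trivial
      · intro a b ha hb; rw [map_add]; exact J.add_mem ha hb
    have hF : ∀ (f : A →ₗ[Z] Z) (a : A), a ∈ J → f a ∈ n := by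
      intro f a ha
      refine Submodule.smul_induction_on ha ?_ ?_
      · intro r hr b _
        rw [map_smul, smul_eq_mul]; exact n.mul_mem_right _ hr
      · intro a b ha hb; rw [map_add]; exact n.add_mem ha hb
    have hsm : ∑ m, w m • v m ∈ J := by
      have : ∑ m, w m • v m = ∑ i, (∑ m, e.toMatrix v i m * w m) • e i := by
        have h1 : ∀ m, v m = ∑ i, e.toMatrix v i m • e i := fun m => (e.sum_toMatrix_smul_self v m).symm
        calc ∑ m, w m • v m = ∑ m, ∑ i, (e.toMatrix v i m * w m) • e i := by
              apply Finset.sum_congr rfl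
              intro m _
              conv_lhs => rw [h1 m]
              rw [Finset.smul_sum]
              apply Finset.sum_congr rfl
              intro i _
              rw [smul_smul, mul_comm]
          _ = _ := by
              rw [Finset.sum_comm]
              apply Finset.sum_congr rfl
              intro i _
              rw [Finset.sum_smul]
      rw [this]
      apply J.sum_mem
      intro i _
      refine Submodule.smul_mem_smul ?_ Submodule.mem_top
      rw [← Ideal.Quotient.eq_zero_iff_mem]
      have := congrFun hw i
      simp only [Matrix.mulVec, dotProduct, Matrix.map_apply, Pi.zero_apply] at this
      rw [map_sum, ← this]
      simp [hww]
    have hwJ := hind J.toAddSubgroup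
      (fun a b hb => hL { toFun := fun b => a * b, map_add' := mul_add a, map_smul' := by
                            intro z b
                            simp only [Subring.smul_def, smul_eq_mul, RingHom.id_apply]
                            rw [← mul_assoc, hcomm, mul_assoc] } b hb)
      (fun a b hb => hL { toFun := fun b => b * a, map_add' := fun b c => add_mul b c a, map_smul' := by
                            intro z b
                            simp only [Subring.smul_def, smul_eq_mul, RingHom.id_apply]
                            rw [mul_assoc] } b hb)
      S T h w hsm
    apply hw0
    funext m
    rw [← hww, Pi.zero_apply, Ideal.Quotient.eq_zero_iff_mem]
    have h1 := hF (e.coord (⟨0, hp0⟩, ⟨0, hp0⟩)) _ (hwJ m)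
    have h2 : ((w m : Z) : A) = w m • e (⟨0, hp0⟩, ⟨0, hp0⟩) := by
      simp [e, Subring.smul_def]
    rw [h2, map_smul] at h1
    simpa using h1
  have htop := (e.is_basis_iff_det.2 hunit).2
  rw [Subring.mem_center_iff]
  intro a
  have ha : a ∈ Submodule.span Z (Set.range v) := htop ▸ trivial
  have hST : T * S ^ p = S ^ p * T := by
    rw [comm_pow h]; simp
  have hv : ∀ m, v m * S ^ p = S ^ p * v m := by
    intro m
    have c1 : Commute (S ^ p) T := hST.symm
    have c2 : Commute (S ^ p) S := Commute.pow_self S p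
    exact ((c2.pow_right _).mul_right (c1.pow_right _)).symm
  induction ha using Submodule.span_induction with
  | mem x h => obtain ⟨m, rfl⟩ := h; exact hv m
  | zero => simp
  | add x y _ _ hx hy => rw [add_mul, mul_add, hx, hy]
  | smul r x _ hx =>
    rw [Subring.smul_def, smul_eq_mul, mul_assoc, hx, ← mul_assoc, ← mul_assoc, hcomm]

end Indep

section CenterW
variable {B : Type} [CommRing B] {p : ℕ} [hp : Fact p.Prime] [CharP B p]

instance wNontriv {B : Type} [CommRing B] [Nontrivial B] : Nontrivial (Weyl B) := by
  refine ⟨⟨mon B (0,0), 0, fun h => ?_⟩⟩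
  have := congrArg (cf (0,0)) h
  simp [cf_mon] at this

theorem w_algebraMap_inj : Function.Injective (algebraMap B (Weyl B)) := by
  intro a b h
  have h2 : ∀ a : B, cf (0,0) (algebraMap B (Weyl B) a) = a := by
    intro a
    have : algebraMap B (Weyl B) a = a • mon B (0,0) := by simp [mon, Algebra.algebraMap_eq_smul_one]
    rw [this, map_smul, cf_mon]; simp
  rw [← h2 a, h, h2]

variable (B p) in
theorem w_charP : CharP (Weyl B) p := charP_of_injective_algebraMap w_algebraMap_inj p

theorem wx_pow_central : Wx B ^ p ∈ Subring.center (Weyl B) := by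
  rw [Subring.mem_center_iff]
  haveI := w_charP B p
  intro a
  let P : Subalgebra B (Weyl B) := Subalgebra.centralizer B {Wx B ^ p}
  have : a ∈ P := by
    apply w_adjoin
    · rw [Subalgebra.mem_centralizer_iff]; simp [← pow_succ, ← pow_succ']
    · rw [Subalgebra.mem_centralizer_iff]; simp [comm_pow (wy_wx B)]
  rw [Subalgebra.mem_centralizer_iff] at this
  exact (this _ rfl).symm

theorem wy_pow_central : Wy B ^ p ∈ Subring.center (Weyl B) := by
  rw [Subring.mem_center_iff]
  haveI := w_charP B p
  intro a
  let P : Subalgebra B (Weyl B) := Subalgebra.centralizer B {Wy B ^ p}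
  have : a ∈ P := by
    apply w_adjoin
    · rw [Subalgebra.mem_centralizer_iff]; simp [comm_pow' (wy_wx B)]
    · rw [Subalgebra.mem_centralizer_iff]; simp [← pow_succ, ← pow_succ']
  rw [Subalgebra.mem_centralizer_iff] at this
  exact (this _ rfl).symm

theorem w_pow_central {S T : Weyl B} (h : T * S = S * T + 1) : S ^ p ∈ Subring.center (Weyl B) := by
  haveI := w_charP B p
  refine pow_central (p := p) (wy_wx B) ?_ h
  rw [eq_top_iff]
  intro a _
  set M := Submodule.span (Subring.center (Weyl B))
      (Set.range (fun m : Fin p × Fin p => Wx B ^ (m.1 : ℕ) * Wy B ^ (m.2 : ℕ))) with hM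
  obtain ⟨F, _, e⟩ := w_repr a
  rw [e]
  apply M.sum_mem
  rintro ⟨i, j⟩ _
  have hp0 := hp.out.pos
  have hz : (cf (i,j) a) • ((Wx B ^ p) ^ (i / p) * (Wy B ^ p) ^ (j / p)) ∈ Subring.center (Weyl B) := by
    rw [Algebra.smul_def]
    refine mul_mem ?_ (mul_mem (pow_mem wx_pow_central _) (pow_mem wy_pow_central _))
    rw [Subring.mem_center_iff]
    intro g
    exact (Algebra.commutes _ _).symm
  have : cf (i,j) a • mon B (i,j) = (⟨_, hz⟩ : Subring.center (Weyl B)) •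
      (Wx B ^ (i % p) * Wy B ^ (j % p)) := by
    rw [Subring.smul_def]
    simp only [smul_eq_mul, smul_mul_assoc]
    congr 1
    have c := Subring.mem_center_iff.1 (pow_mem (wy_pow_central (B := B) (p := p)) (j / p)) (Wx B ^ (i % p))
    rw [mul_assoc, ← mul_assoc ((Wy B ^ p) ^ (j / p)), ← c, mon]
    simp only [← pow_mul, mul_assoc, ← pow_add]
    rw [← mul_assoc, ← pow_add, Nat.div_add_mod, Nat.div_add_mod]
  rw [this]
  exact M.smul_mem _ (Submodule.subset_span ⟨(⟨i % p, Nat.mod_lt _ hp0⟩, ⟨j % p, Nat.mod_lt _ hp0⟩), rfl⟩)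

theorem cf_central {a : Weyl B} (ha : a ∈ Subring.center (Weyl B)) (m : ℕ × ℕ)
    (hm : ¬ (p ∣ m.1 ∧ p ∣ m.2)) : cf m a = 0 := by
  have inv : ∀ (n : ℕ), ¬ p ∣ n → ∀ b : B, (n : B) * b = 0 → b = 0 := by
    intro n hn b hb
    have : IsUnit (n : B) := (CharP.isUnit_natCast_iff (p := p) hp.out).2 hn
    exact (this.mul_right_eq_zero).1 hb
  rw [Subring.mem_center_iff] at ha
  rcases m with ⟨i, j⟩
  by_cases hi : p ∣ i
  · have hj : ¬ p ∣ j := fun hj => hm ⟨hi, hj⟩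
    rcases j with _ | j
    · simp at hj
    · have := cf_adx a (i, j)
      rw [ha, sub_self, map_zero] at this
      apply inv _ hj; push_cast; exact this.symm
  · rcases i with _ | i
    · simp at hi
    · have := cf_ady a (i, j)
      rw [ha, sub_self, map_zero] at this
      apply inv _ hi; push_cast; exact this.symm
end CenterW

section Delta

theorem delta_exists {A A' : Type} [Ring A] [Ring A'] (π : A →+* A') (hs : Function.Surjective π)
    (p : ℕ) (hk : ∀ a, π a = 0 → ∃ b, a = (p : A) * b) (ht : ∀ a : A, (p : A) * a = 0 → a = 0)
    (c : A) (hc : ∀ x, π c * x = x * π c) :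
    ∃ δ : A' →+ A', (∀ x w, c * x - x * c = (p : A) * w → δ (π x) = π w) ∧
      ∀ x y, δ (x * y) = δ x * y + x * δ y := by
  have hex : ∀ x : A, ∃ w, c * x - x * c = (p : A) * w := by
    intro x
    apply hk
    rw [map_sub, map_mul, map_mul, hc, sub_self]
  choose br hbr using hex
  choose li hli using hs
  have key : ∀ x w, c * x - x * c = (p : A) * w → π (br (li (π x))) = π w := by
    intro x w hw
    obtain ⟨y, hy⟩ := hk (li (π x) - x) (by rw [map_sub, hli, sub_self])
    have h1 := hbr (li (π x))
    have h2 : li (π x) = x + (p : A) * y := by rw [← hy]; abel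
    have hcp : c * (p : A) = (p : A) * c := (Nat.cast_commute p c).symm
    have h3 : (p : A) * (br (li (π x)) - w - (c * y - y * c)) = 0 := by
      rw [mul_sub, mul_sub, ← h1, ← hw]
      rw [h2]
      rw [mul_add, add_mul, ← mul_assoc c, hcp, mul_assoc, mul_assoc, mul_sub]
      abel
    have h4 := ht _ h3
    have h5 : br (li (π x)) = w + (c * y - y * c) := by
      rw [sub_sub, sub_eq_zero] at h4; exact h4
    rw [h5, map_add, map_sub, map_mul, map_mul, hc, sub_self, add_zero]
  refine ⟨⟨⟨fun x => π (br (li x)), ?_⟩, ?_⟩, ?_, ?_⟩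
  · have := key 0 0 (by simp)
    simpa using this
  · intro x y
    have := key (li x + li y) (br (li x) + br (li y)) (by
      rw [mul_add (p : A), ← hbr, ← hbr]; noncomm_ring)
    simp only [map_add, hli] at this
    exact this
  · intro x w hw
    exact key x w hw
  · intro x y
    have := key (li x * li y) (br (li x) * li y + li x * br (li y)) (by
      have hcp : li x * (p : A) = (p : A) * li x := (Nat.cast_commute p _).symm
      rw [mul_add (p : A), ← mul_assoc (p : A), ← hbr, ← mul_assoc (p : A), ← hcp, mul_assoc (li x) (p : A), ← hbr]
      noncomm_ring)
    simp only [map_add, map_mul, hli] at this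
    exact this

theorem comm_ppow {A : Type} [Ring A] {S T : A} (h : T * S = S * T + 1) (p : ℕ) (hp : p.Prime) :
    ∃ G : A, T ^ p * S ^ p - S ^ p * T ^ p = (p : A) * (((p - 1).factorial : ℕ) + (p : A) * G) := by
  let L := LinearMap.mulLeft ℤ T
  let Rr := LinearMap.mulRight ℤ T
  let D := L - Rr
  have hLR : Commute L Rr := LinearMap.commute_mulLeft_right T T
  have hDR : Commute D Rr := hLR.sub_left (Commute.refl _)
  have hDp : ∀ n m, (D ^ m) (S ^ n) = (n.descFactorial m : A) * S ^ (n - m) := by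
    intro n m
    induction m with
    | zero => simp
    | succ m ih =>
      rw [pow_succ', Module.End.mul_apply, ih]
      have : ∀ (k q : ℕ), D ((q : A) * S ^ k) = (q : A) * ((k : A) * S ^ (k - 1)) := by
        intro k q
        change T * ((q : A) * S ^ k) - (q : A) * S ^ k * T = _
        rw [← mul_assoc, ← Nat.cast_comm q T, mul_assoc, mul_assoc, ← mul_sub, comm_pow h]
        abel_nf
      rw [this, Nat.descFactorial_succ, ← mul_assoc, ← Nat.cast_mul, mul_comm, Nat.sub_sub]
  have hsum := hDR.add_pow p
  have hDL : D + Rr = L := sub_add_cancel _ _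
  rw [hDL] at hsum
  have h2 := congrArg (fun f : Module.End ℤ A => f (S ^ p)) hsum
  have hL : (L ^ p) (S ^ p) = T ^ p * S ^ p := by
    simp only [L, LinearMap.pow_mulLeft, LinearMap.mulLeft_apply]
  simp only [hL, LinearMap.sum_apply] at h2
  have hterm : ∀ m, (D ^ m * Rr ^ (p - m) * ((p.choose m : ℕ) : Module.End ℤ A)) (S ^ p)
      = ((p.choose m * p.descFactorial m : ℕ) : A) * (S ^ (p - m) * T ^ (p - m)) := by
    intro m
    rw [((hDR.pow_pow m (p-m))).eq, ← Nat.cast_comm, Module.End.mul_apply, Module.End.mul_apply, hDp]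
    have : ∀ k x, (Rr ^ k) x = x * T ^ k := by
      intro k x
      simp only [Rr, LinearMap.pow_mulRight, LinearMap.mulRight_apply]
    rw [this, Module.End.natCast_apply, nsmul_eq_mul, Nat.cast_mul, mul_assoc, mul_assoc]
  simp only [hterm] at h2
  have hp0 := hp.pos
  obtain ⟨q, rfl⟩ : ∃ q, p = q + 1 := ⟨p - 1, by omega⟩
  rw [Finset.sum_range_succ, Finset.sum_range_succ'] at h2
  have hmid : ∃ G : A, ∑ k ∈ Finset.range q, (((q+1).choose (k+1) * (q+1).descFactorial (k+1) : ℕ) : A)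
      * (S ^ (q + 1 - (k+1)) * T ^ (q + 1 - (k+1))) = ((q+1 : ℕ) : A) * (((q+1 : ℕ) : A) * G) := by
    have : ∀ k ∈ Finset.range q, ∃ e : ℕ, (q+1).choose (k+1) * (q+1).descFactorial (k+1) = (q+1) * ((q+1) * e) := by
      intro k hk
      rw [Finset.mem_range] at hk
      obtain ⟨e, he⟩ := hp.dvd_choose_self (k := k+1) (by omega) (by omega)
      rw [Nat.descFactorial_eq_factorial_mul_choose, he]
      exact ⟨e * ((k+1).factorial * e), by ring⟩
    choose! e he using this
    refine ⟨∑ k ∈ Finset.range q, (e k : A) * (S ^ (q + 1 - (k+1)) * T ^ (q + 1 - (k+1))), ?_⟩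
    rw [Finset.mul_sum, Finset.mul_sum]
    apply Finset.sum_congr rfl
    intro k hk
    rw [he k hk]
    push_cast
    simp only [mul_assoc]
  obtain ⟨G, hG⟩ := hmid
  rw [hG] at h2
  refine ⟨G, ?_⟩
  rw [h2]
  simp only [Nat.choose_zero_right, Nat.descFactorial_zero, Nat.choose_self, Nat.descFactorial_self,
    Nat.sub_self, pow_zero, Nat.sub_zero, mul_one, one_mul, Nat.cast_one, Nat.factorial_succ,
    Nat.add_sub_cancel, mul_add]
  push_cast
  abel

end Delta

section Poisson

theorem der_mono {B Z A : Type} [CommRing B] [CommRing Z] [Algebra B Z] [AddCommGroup A] [Module Z A]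
    [Module B A] [IsScalarTower B Z A] (D : Derivation B Z A) (u v : Z) (F : Finset (ℕ × ℕ)) (c : ℕ × ℕ → B) :
    (u * v) • D (∑ m ∈ F, c m • (u ^ m.1 * v ^ m.2)) =
      ∑ m ∈ F, (c m • (u ^ m.1 * v ^ m.2)) • ((m.1 : Z) • v • D u + (m.2 : Z) • u • D v) := by
  have hpw : ∀ (x : Z) (n : ℕ), x • D (x ^ n) = (x ^ n * n) • D x := by
    intro x n
    rw [Derivation.leibniz_pow, ← Nat.cast_smul_eq_nsmul Z, smul_smul, smul_smul]
    cases n with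
    | zero => simp
    | succ n => congr 1; simp; ring
  rw [map_sum, Finset.smul_sum]
  apply Finset.sum_congr rfl
  intro m _
  rw [Derivation.map_smul, Derivation.leibniz, smul_comm (u*v), smul_assoc]
  congr 1
  rw [smul_add, smul_smul, smul_smul,
    show u * v * u ^ m.1 = u ^ (m.1 + 1) * v by ring, show u * v * v ^ m.2 = v ^ (m.2+1) * u by ring,
    mul_smul, mul_smul, hpw, hpw]
  module

theorem poisson {B Z A : Type} [CommRing B] [CommRing Z] [Algebra B Z] [AddCommGroup A] [Module Z A]
    [Module B A] [IsScalarTower B Z A] (D DX DY : Derivation B Z A) (e : A) (u v P Q w : Z)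
    (F : Finset (ℕ × ℕ)) (s t : ℕ × ℕ → B)
    (hP : P = ∑ m ∈ F, s m • (u ^ m.1 * v ^ m.2))
    (hQ : Q = ∑ m ∈ F, t m • (u ^ m.1 * v ^ m.2))
    (h1 : D P = w • e) (h2 : DX u = 0) (h3 : DX v = -(w • e)) (h4 : DY v = 0) (h5 : DY u = w • e)
    (h6 : D u = -DX Q) (h7 : D v = -DY Q) :
    ((u * v) * (u * v) * w) • e = (∑ m ∈ F, ∑ m' ∈ F, w * (u * v) * ((s m * t m') •
      (((m.1 : Z) * m'.2 - m.2 * m'.1) * (u ^ (m.1 + m'.1) * v ^ (m.2 + m'.2))))) • e := by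
  have a1 : (u * v) • D u = (∑ m ∈ F, (t m • (u ^ m.1 * v ^ m.2)) * m.2 * u * w) • e := by
    rw [h6, smul_neg, hQ, der_mono, h2, h3, Finset.sum_smul, ← Finset.sum_neg_distrib]
    apply Finset.sum_congr rfl
    intro m _
    rw [smul_zero, smul_zero, zero_add]
    module
  have a2 : (u * v) • D v = -(∑ m ∈ F, (t m • (u ^ m.1 * v ^ m.2)) * m.1 * v * w) • e := by
    rw [h7, smul_neg, hQ, der_mono, h4, h5, neg_smul, Finset.sum_smul]
    congr 1
    apply Finset.sum_congr rfl
    intro m _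
    rw [smul_zero, smul_zero, add_zero]
    module
  have a3 : ((u * v) * (u * v) * w) • e = (u * v) • (u * v) • D P := by
    rw [h1]; module
  rw [a3, hP, der_mono, Finset.smul_sum, Finset.sum_smul]
  apply Finset.sum_congr rfl
  intro m _
  have : (u * v) • (s m • (u ^ m.1 * v ^ m.2)) • ((m.1 : Z) • v • D u + (m.2 : Z) • u • D v) =
    (s m • (u ^ m.1 * v ^ m.2)) • ((m.1 : Z) • v • (u * v) • D u + (m.2 : Z) • u • (u * v) • D v) := by
    module
  rw [this, a1, a2, smul_smul, smul_smul, smul_smul, smul_smul, ← add_smul, smul_smul]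
  congr 1
  rw [mul_neg, ← sub_eq_add_neg, Finset.mul_sum, Finset.mul_sum, ← Finset.sum_sub_distrib, Finset.mul_sum]
  apply Finset.sum_congr rfl
  intro m' _
  simp only [Algebra.smul_def, map_mul]
  ring

end Poisson

section CoefId
variable {R B : Type} [CommRing R] [CommRing B] [Algebra R B] {p : ℕ}

theorem cf_natmul (n : ℕ) (m) (a : Weyl R) : cf m ((n : Weyl R) * a) = (n : R) * cf m a := by
  rw [← nsmul_eq_mul, map_nsmul, nsmul_eq_mul]

theorem wMap_surj (hs : Function.Surjective (algebraMap R B)) : Function.Surjective (wMap R B) := by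
  intro a
  obtain ⟨F, -, ha⟩ := w_repr a
  choose li hli using hs
  refine ⟨∑ m ∈ F, li (cf m a) • mon R m, ?_⟩
  conv_rhs => rw [ha]
  rw [map_sum]
  apply Finset.sum_congr rfl
  intro m _
  rw [map_smul, wMap_mon, ← algebraMap_smul B (li _), hli]

theorem wMap_ker (hk : ∀ r, algebraMap R B r = 0 → ∃ b, r = (p : R) * b) (a : Weyl R)
    (ha : wMap R B a = 0) : ∃ b, a = (p : Weyl R) * b := by
  have : ∀ m, ∃ b, cf m a = (p : R) * b := by
    intro m
    apply hk
    rw [← cf_map, ha, map_zero]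
  choose b hb using this
  obtain ⟨F, -, hF⟩ := w_repr a
  refine ⟨∑ m ∈ F, b m • mon R m, ?_⟩
  rw [Finset.mul_sum]
  conv_lhs => rw [hF]
  apply Finset.sum_congr rfl
  intro m _
  rw [hb, mul_smul, Nat.cast_smul_eq_nsmul, nsmul_eq_mul]

theorem w_tors (ht : ∀ a : R, (p : R) * a = 0 → a = 0) (a : Weyl R) (ha : (p : Weyl R) * a = 0) : a = 0 := by
  apply w_ext
  intro m
  rw [map_zero]
  apply ht
  rw [← cf_natmul, ha, map_zero]

theorem delta_der (hs : Function.Surjective (algebraMap R B))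
    (hk : ∀ r, algebraMap R B r = 0 → ∃ b, r = (p : R) * b)
    (ht : ∀ a : R, (p : R) * a = 0 → a = 0)
    (c : Weyl R) (hc : ∀ x, wMap R B c * x = x * wMap R B c) :
    ∃ D : Derivation B (Subalgebra.center B (Weyl B)) (Weyl B),
      ∀ x w (z : Subalgebra.center B (Weyl B)), c * x - x * c = (p : Weyl R) * w →
        (z : Weyl B) = wMap R B x → D z = wMap R B w := by
  obtain ⟨δ, h1, h2⟩ := delta_exists (wMap R B : Weyl R →+* Weyl B) (wMap_surj hs) p (wMap_ker hk)
    (w_tors ht) c hc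
  have h0 : ∀ b : B, δ (algebraMap B _ b) = 0 := by
    intro b
    obtain ⟨r, rfl⟩ := hs b
    have := h1 (algebraMap R _ r) 0 (by rw [Algebra.commutes, sub_self, mul_zero])
    simp only [RingHom.coe_coe, map_zero] at this
    rw [← this, AlgHom.commutes, ← IsScalarTower.algebraMap_apply]
  refine ⟨⟨⟨⟨fun z => δ z, ?_⟩, ?_⟩, ?_, ?_⟩, ?_⟩
  · intro x y; simp
  · intro b x
    simp only [SetLike.val_smul, RingHom.id_apply]
    rw [Algebra.smul_def, h2, h0, zero_mul, zero_add, ← Algebra.smul_def]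
  · change δ ((1 : Weyl B)) = 0
    rw [← map_one (algebraMap B (Weyl B)), h0]
  · intro a b
    change δ ((a : Weyl B) * b) = (a : Weyl B) * δ b + (b : Weyl B) * δ a
    rw [h2, add_comm]
    congr 1
    exact ((Subalgebra.mem_center_iff.1 b.2) _)
  · intro x w z hw hz
    change δ z = _
    rw [hz]
    exact h1 x w hw

end CoefId

section CoefId2
variable {R B : Type} [CommRing R] [CommRing B] [Algebra R B] {p : ℕ}

theorem mon_pp (m : ℕ × ℕ) : mon B (p * m.1, p * m.2) = (Wx B ^ p) ^ m.1 * (Wy B ^ p) ^ m.2 := by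
  simp only [mon, pow_mul]

theorem center_repr [hp : Fact p.Prime] [CharP B p] {a : Weyl B} (ha : a ∈ Subring.center (Weyl B))
    (F : Finset (ℕ × ℕ)) (hF : ∀ m, m ∉ F → cf (p * m.1, p * m.2) a = 0) :
    a = ∑ m ∈ F, cf (p * m.1, p * m.2) a • ((Wx B ^ p) ^ m.1 * (Wy B ^ p) ^ m.2) := by
  have hp0 := hp.out.pos
  have h := w_repr' a (F.image (fun m => (p * m.1, p * m.2))) (by
    intro m hm
    by_cases hd : p ∣ m.1 ∧ p ∣ m.2
    · obtain ⟨⟨i, hi⟩, ⟨j, hj⟩⟩ := hd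
      have : m = (p * i, p * j) := Prod.ext hi hj
      rw [this] at hm ⊢
      apply hF (i, j)
      intro h
      exact hm (Finset.mem_image.2 ⟨(i,j), h, rfl⟩)
    · exact cf_central ha m hd)
  rw [Finset.sum_image] at h
  · conv_lhs => rw [h]
    apply Finset.sum_congr rfl
    intro m _
    rw [mon_pp]
  · intro x _ y _ hxy
    simp only [Prod.mk.injEq] at hxy
    exact Prod.ext (Nat.eq_of_mul_eq_mul_left hp0 hxy.1) (Nat.eq_of_mul_eq_mul_left hp0 hxy.2)

theorem neg_rel3 {A : Type} [Ring A] {x y : A} (h : y * x = x * y + 1) : (-x) * y = y * (-x) + 1 := by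
  rw [neg_mul, mul_neg, h]; abel

theorem neg_br {A : Type} [Ring A] {a b p c : A} (h : a * b - b * a = p * c) : b * a - a * b = p * (-c) := by
  rw [mul_neg, ← h, neg_sub]

theorem alg_aux {Z : Type} [CommRing Z] [Algebra B Z] (w0 : B) (u v : Z) (F : Finset (ℕ × ℕ)) (s t : ℕ × ℕ → B)
    (h : u * v * (u * v) * algebraMap B Z w0 = ∑ m ∈ F, ∑ m' ∈ F, algebraMap B Z w0 * (u * v) * ((s m * t m') •
      (((m.1 : Z) * m'.2 - m.2 * m'.1) * (u ^ (m.1 + m'.1) * v ^ (m.2 + m'.2))))) :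
    w0 • (u ^ 2 * v ^ 2) = ∑ m ∈ F, ∑ m' ∈ F,
        (w0 * (((m.1 : B) * m'.2 - m.2 * m'.1) * (s m * t m'))) •
          (u ^ ((m + m').1 + 1) * v ^ ((m + m').2 + 1)) := by
  rw [Algebra.smul_def]
  trans u * v * (u * v) * algebraMap B Z w0
  · ring
  rw [h]
  apply Finset.sum_congr rfl
  intro m _
  apply Finset.sum_congr rfl
  intro m' _
  simp only [Algebra.smul_def, map_mul, map_sub, map_natCast, Prod.fst_add, Prod.snd_add]
  ring

theorem coef_identity [hp : Fact p.Prime] [CharP B p] (hs : Function.Surjective (algebraMap R B))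
    (hk : ∀ r, algebraMap R B r = 0 → ∃ b, r = (p : R) * b)
    (ht : ∀ a : R, (p : R) * a = 0 → a = 0)
    (S T : Weyl R) (h : T * S = S * T + 1) (F : Finset (ℕ × ℕ))
    (hSF : ∀ m, m ∉ F → cf (p * m.1, p * m.2) (wMap R B S ^ p) = 0)
    (hTF : ∀ m, m ∉ F → cf (p * m.1, p * m.2) (wMap R B T ^ p) = 0) (n : ℕ × ℕ) :
    (((p - 1).factorial : ℕ) : B) * ∑ m ∈ F, ∑ m' ∈ F, (if m + m' = n then
      ((m.1 : B) * m'.2 - m.2 * m'.1) * (cf (p * m.1, p * m.2) (wMap R B S ^ p) *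
        cf (p * m'.1, p * m'.2) (wMap R B T ^ p)) else 0) =
    (((p - 1).factorial : ℕ) : B) * (if n = (1, 1) then 1 else 0) := by
  have hp0 := hp.out.pos
  have hcen : ∀ {a : Weyl B}, a ∈ Subring.center (Weyl B) → a ∈ Subalgebra.center B (Weyl B) := by
    intro a ha
    rw [Subalgebra.mem_center_iff]
    exact Subring.mem_center_iff.1 ha
  have hcc : ∀ {a : Weyl B}, a ∈ Subring.center (Weyl B) → ∀ x, a * x = x * a := by
    intro a ha x
    exact (Subring.mem_center_iff.1 ha x).symm
  have hSc : wMap R B S ^ p ∈ Subring.center (Weyl B) := by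
    apply w_pow_central (T := wMap R B T)
    rw [← map_mul, h, map_add, map_mul, map_one]
  have hTc : wMap R B T ^ p ∈ Subring.center (Weyl B) := by
    apply w_pow_central (T := -wMap R B S)
    refine neg_rel3 ?_
    rw [← map_mul, h, map_add, map_mul, map_one]
  have hXc : Wx B ^ p ∈ Subring.center (Weyl B) := wx_pow_central
  have hYc : Wy B ^ p ∈ Subring.center (Weyl B) := wy_pow_central
  have hpX : wMap R B (Wx R ^ p) = Wx B ^ p := by
    rw [map_pow]; congr 1; simp [wMap]
  have hpY : wMap R B (Wy R ^ p) = Wy B ^ p := by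
    rw [map_pow]; congr 1; simp [wMap]
  obtain ⟨D, hD⟩ := delta_der hs hk ht (T ^ p) (by rw [map_pow]; exact hcc hTc)
  obtain ⟨DX, hDX⟩ := delta_der hs hk ht (Wx R ^ p) (by rw [hpX]; exact hcc hXc)
  obtain ⟨DY, hDY⟩ := delta_der hs hk ht (Wy R ^ p) (by rw [hpY]; exact hcc hYc)
  let P : Subalgebra.center B (Weyl B) := ⟨_, hcen hSc⟩
  let Q : Subalgebra.center B (Weyl B) := ⟨_, hcen hTc⟩
  let u : Subalgebra.center B (Weyl B) := ⟨_, hcen hXc⟩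
  let v : Subalgebra.center B (Weyl B) := ⟨_, hcen hYc⟩
  let w : Subalgebra.center B (Weyl B) := algebraMap B _ (((p - 1).factorial : ℕ) : B)
  let s := fun m : ℕ × ℕ => cf (p * m.1, p * m.2) (wMap R B S ^ p)
  let t := fun m : ℕ × ℕ => cf (p * m.1, p * m.2) (wMap R B T ^ p)
  have huv : ∀ a b : ℕ, ((u ^ a * v ^ b : Subalgebra.center B (Weyl B)) : Weyl B) = mon B (p * a, p * b) := by
    intro a b
    rw [mon_pp (a, b)]
    rfl
  have hp0' : wMap R B (p : Weyl R) = 0 := by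
    have : CharP (Weyl B) p := w_charP B p
    rw [map_natCast, CharP.cast_eq_zero]
  have hwG : ∀ G, wMap R B ((((p - 1).factorial : ℕ) : Weyl R) + (p : Weyl R) * G) = w • (1 : Weyl B) := by
    intro G
    rw [map_add, map_mul, hp0', zero_mul, add_zero, map_natCast]
    change _ = (w : Weyl B) * 1
    simp [w]
  have key := poisson D DX DY 1 u v P Q w F s t ?_ ?_ ?_ ?_ ?_ ?_ ?_ ?_ ?_
  · have e : ∀ z : Subalgebra.center B (Weyl B), z • (1 : Weyl B) = z := by
      intro z; change (z : Weyl B) * 1 = z; rw [mul_one]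
    rw [e, e] at key
    have key2 := Subtype.ext key
    have key3 : (((p - 1).factorial : ℕ) : B) • (u ^ 2 * v ^ 2) = ∑ m ∈ F, ∑ m' ∈ F,
        ((((p - 1).factorial : ℕ) : B) * (((m.1 : B) * m'.2 - m.2 * m'.1) * (s m * t m'))) •
          (u ^ ((m + m').1 + 1) * v ^ ((m + m').2 + 1)) := by
      exact alg_aux _ u v F s t key2
    have key4 := congrArg (fun z : Subalgebra.center B (Weyl B) => cf (p * (n.1 + 1), p * (n.2 + 1)) (z : Weyl B)) key3
    simp only [AddSubmonoidClass.coe_finsetSum, SetLike.val_smul, huv, map_sum, map_smul, cf_mon, smul_eq_mul] at key4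
    have hiff : ∀ a : ℕ × ℕ, ((p * (n.1 + 1), p * (n.2 + 1)) = (p * (a.1 + 1), p * (a.2 + 1))) ↔ a = n := by
      intro a
      rw [Prod.mk.injEq, Nat.mul_right_inj hp0.ne', Nat.mul_right_inj hp0.ne', Prod.ext_iff]
      omega
    have hiff2 : ((p * (n.1 + 1), p * (n.2 + 1)) = (p * 2, p * 2)) ↔ n = (1, 1) := by
      rw [hiff (1, 1)]; exact eq_comm
    simp only [hiff, hiff2] at key4
    rw [key4, Finset.mul_sum]
    apply Finset.sum_congr rfl
    intro m _
    rw [Finset.mul_sum]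
    apply Finset.sum_congr rfl
    intro m' _
    split_ifs <;> simp [s, t]
  · apply Subtype.ext
    have := center_repr hSc F hSF
    simp only [AddSubmonoidClass.coe_finsetSum, SetLike.val_smul]
    exact this
  · apply Subtype.ext
    have := center_repr hTc F hTF
    simp only [AddSubmonoidClass.coe_finsetSum, SetLike.val_smul]
    exact this
  · obtain ⟨G, hG⟩ := comm_ppow h p hp.out
    rw [hD _ _ P hG (map_pow _ _ _).symm, hwG]
  · rw [hDX (Wx R ^ p) 0 u (by rw [sub_self, mul_zero]) hpX.symm, map_zero]
  · obtain ⟨G, hG⟩ := comm_ppow (wy_wx R) p hp.out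
    rw [hDX (Wy R ^ p) (-((((p - 1).factorial : ℕ) : Weyl R) + (p : Weyl R) * G)) v (neg_br hG) hpY.symm, map_neg, hwG]
  · rw [hDY (Wy R ^ p) 0 v (by rw [sub_self, mul_zero]) hpY.symm, map_zero]
  · obtain ⟨G, hG⟩ := comm_ppow (wy_wx R) p hp.out
    rw [hDY _ _ u hG hpX.symm, hwG]
  · obtain ⟨b, hb⟩ := wMap_ker hk (T ^ p * Wx R ^ p - Wx R ^ p * T ^ p) (by
      rw [map_sub, map_mul, map_mul, hpX, hcc hXc, sub_self])
    rw [hD _ b u hb hpX.symm, hDX (T ^ p) (-b) Q (neg_br hb) (map_pow _ _ _).symm, map_neg, neg_neg]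
  · obtain ⟨b, hb⟩ := wMap_ker hk (T ^ p * Wy R ^ p - Wy R ^ p * T ^ p) (by
      rw [map_sub, map_mul, map_mul, hpY, hcc hYc, sub_self])
    rw [hD _ b v hb hpY.symm, hDY (T ^ p) (-b) Q (neg_br hb) (map_pow _ _ _).symm, map_neg, neg_neg]

end CoefId2

section Deg
open Polynomial
variable {R : Type} [CommRing R]

def Bd (N M : ℕ) (a : Weyl R) : Prop := ∀ m : ℕ × ℕ, (N < m.1 ∨ M < m.2) → cf m a = 0

theorem cf_def (m : ℕ × ℕ) (a : Weyl R) : cf m a = ((wSym a).coeff m.1).coeff m.2 := rfl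

theorem Bd.x {N M : ℕ} {a : Weyl R} (h : Bd N M a) : Bd (N + 1) M (Wx R * a) := by
  rintro ⟨i, j⟩ hm
  rw [cf_def, wSym_mul, wRep_x]
  cases i with
  | zero => simp
  | succ i =>
    rw [coeff_X_mul]
    exact h (i, j) (by simpa using hm)

theorem Bd.y {N M : ℕ} {a : Weyl R} (h : Bd N M a) : Bd N (M + 1) (Wy R * a) := by
  rintro ⟨i, j⟩ hm
  simp only at hm
  rw [cf_def, wSym_mul, wRep_y, coeff_add, coeff_derivative, coeff_C_mul, coeff_add]
  have h1 : (((wSym a).coeff (i + 1)).coeff j) = 0 := h (i + 1, j) (by simp only; omega)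
  have h2 : ((wSym a).coeff (i + 1) * ((i : R[X]) + 1)).coeff j = 0 := by
    rw [show ((i : R[X]) + 1) = ((i + 1 : ℕ) : R[X]) by push_cast; rfl, ← nsmul_eq_mul', coeff_smul, h1, smul_zero]
  simp only
  rw [h2, zero_add]
  cases j with
  | zero => simp
  | succ j =>
    rw [coeff_X_mul]
    exact h (i, j) (by simpa using hm)

theorem Bd.mon {N M : ℕ} {a : Weyl R} (h : Bd N M a) (m : ℕ × ℕ) : Bd (m.1 + N) (m.2 + M) (mon R m * a) := by
  have hy : ∀ j : ℕ, Bd N (j + M) (Wy R ^ j * a) := by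
    intro j
    induction j with
    | zero => simpa using h
    | succ j ih =>
      rw [pow_succ', mul_assoc, show j + 1 + M = j + M + 1 by ring]
      exact ih.y
  rw [_root_.mon, mul_assoc]
  obtain ⟨i, j⟩ := m
  simp only
  induction i with
  | zero => simpa using hy j
  | succ i ih =>
    rw [pow_succ', mul_assoc, show i + 1 + N = i + N + 1 by ring]
    exact ih.x

theorem Bd.mul {N M N' M' : ℕ} {a b : Weyl R} (ha : Bd N M a) (hb : Bd N' M' b) :
    Bd (N + N') (M + M') (a * b) := by
  obtain ⟨F, -, hF⟩ := w_repr a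
  intro n hn
  rw [hF, Finset.sum_mul, map_sum]
  apply Finset.sum_eq_zero
  intro m _
  rw [smul_mul_assoc, map_smul]
  by_cases hm : N < m.1 ∨ M < m.2
  · rw [ha m hm, zero_smul]
  · rw [hb.mon m n (by omega), smul_zero]

theorem Bd.pow {N M : ℕ} {a : Weyl R} (ha : Bd N M a) (n : ℕ) : Bd (n * N) (n * M) (a ^ n) := by
  induction n with
  | zero =>
    intro m hm
    have : (1 : Weyl R) = _root_.mon R (0, 0) := by simp [_root_.mon]
    rw [pow_zero, this, cf_mon, if_neg]
    rintro rfl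
    simp at hm
  | succ n ih =>
    rw [pow_succ', show (n+1) * N = N + n * N by ring, show (n+1) * M = M + n * M by ring]
    exact ha.mul ih

theorem lead_mon {N N' : ℕ} (m : ℕ × ℕ) (hm : m.1 ≤ N) (g : R[X][X]) (hg : g.natDegree ≤ N') :
    (wRep R (mon R m) g).natDegree ≤ N + N' ∧
    (wRep R (mon R m) g).coeff (N + N') = (wSym (mon R m)).coeff N * g.coeff N' := by
  have hy : ∀ j : ℕ, (wRep R (Wy R ^ j) g).natDegree ≤ N' ∧ (wRep R (Wy R ^ j) g).coeff N' = X ^ j * g.coeff N' := by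
    intro j
    induction j with
    | zero => simpa using hg
    | succ j ih =>
      rw [pow_succ', map_mul, Module.End.mul_apply, wRep_y]
      constructor
      · refine (natDegree_add_le _ _).trans (max_le ?_ ?_)
        · exact (natDegree_derivative_le _).trans (by omega)
        · exact (natDegree_C_mul_le _ _).trans ih.1
      · rw [coeff_add, coeff_C_mul, ih.2, coeff_derivative, coeff_eq_zero_of_natDegree_lt (by omega)]
        ring
  have hx : ∀ (i : ℕ) (h : R[X][X]), wRep R (Wx R ^ i) h = X ^ i * h := by
    intro i h
    induction i with
    | zero => simp
    | succ i ih => rw [pow_succ', map_mul, Module.End.mul_apply, wRep_x, ih]; ring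
  obtain ⟨h1, h2⟩ := hy m.2
  rw [wRep_mon, mon, map_mul, Module.End.mul_apply, hx]
  constructor
  · refine natDegree_mul_le.trans ?_
    have := natDegree_X_pow_le (R := R[X]) m.1
    omega
  · rw [coeff_C_mul, coeff_X_pow]
    split_ifs with he
    · rw [he, add_comm, coeff_X_pow_mul, h2, mul_one]
    · rw [mul_zero, zero_mul]
      rw [coeff_X_pow_mul', if_pos (by omega), coeff_eq_zero_of_natDegree_lt (by omega)]

theorem lead_mul {N N' : ℕ} (a b : Weyl R) (ha : (wSym a).natDegree ≤ N) (hb : (wSym b).natDegree ≤ N') :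
    (wSym (a * b)).natDegree ≤ N + N' ∧
    (wSym (a * b)).coeff (N + N') = (wSym a).coeff N * (wSym b).coeff N' := by
  have h0 : ∀ m : ℕ × ℕ, N < m.1 → cf m a = 0 := by
    intro m hm
    rw [cf_def, coeff_eq_zero_of_natDegree_lt (by omega : _ < m.1), coeff_zero]
  obtain ⟨F, -, hF⟩ := w_repr a
  have e1 : wSym (a * b) = ∑ m ∈ F, cf m a • wRep R (mon R m) (wSym b) := by
    rw [wSym_mul]
    conv_lhs => rw [hF]
    rw [map_sum, LinearMap.sum_apply]
    simp only [map_smul, LinearMap.smul_apply]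
  have e2 : wSym a = ∑ m ∈ F, cf m a • wSym (mon R m) := by
    conv_lhs => rw [hF]
    simp only [wSym]
    rw [map_sum, LinearMap.sum_apply]
    simp only [map_smul, LinearMap.smul_apply]
  constructor
  · rw [e1]
    apply natDegree_sum_le_of_forall_le
    intro m _
    by_cases hm : N < m.1
    · rw [h0 m hm, zero_smul]; simp
    · exact (natDegree_smul_le _ _).trans (lead_mon m (by omega) _ hb).1
  · rw [e1, finsetSum_coeff]
    conv_rhs => rw [e2]
    rw [finsetSum_coeff, Finset.sum_mul]
    apply Finset.sum_congr rfl
    intro m _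
    by_cases hm : N < m.1
    · rw [h0 m hm, zero_smul, zero_smul]; simp
    · rw [coeff_smul, coeff_smul, (lead_mon m (by omega) _ hb).2, smul_mul_assoc]

theorem lead_pow {N : ℕ} (a : Weyl R) (ha : (wSym a).natDegree ≤ N) (n : ℕ) :
    (wSym (a ^ n)).natDegree ≤ n * N ∧ (wSym (a ^ n)).coeff (n * N) = (wSym a).coeff N ^ n := by
  induction n with
  | zero => simp [wSym]
  | succ n ih =>
    rw [pow_succ', show (n + 1) * N = N + n * N by ring, pow_succ', ← ih.2]
    exact lead_mul a (a ^ n) ha ih.1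

theorem root_Y {k : Type} [Field k] {p : ℕ} (hp : 0 < p) (T : Weyl k)
    (h : ∀ m, m ≠ (0, p) → cf m (T ^ p) = 0) (m : ℕ × ℕ) (hm : m ≠ (0, 0)) (hm' : m ≠ (0, 1)) : cf m T = 0 := by
  obtain ⟨h1, h2⟩ := lead_pow T le_rfl p
  set N := (wSym T).natDegree with hN
  set A := (wSym T).coeff N with hA
  by_cases hA0 : A = 0
  · have : wSym T = 0 := by rw [← leadingCoeff_eq_zero]; exact hA0
    rw [cf_def, this]; simp
  have hAp : A ^ p ≠ 0 := pow_ne_zero _ hA0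
  have hN0 : N = 0 := by
    by_contra hne
    apply hAp
    rw [← h2]
    ext j
    rw [coeff_zero]
    apply h (p * N, j)
    intro he
    rw [Prod.mk.injEq] at he
    have := Nat.mul_pos hp (Nat.pos_of_ne_zero hne)
    omega
  have hd : A.natDegree ≤ 1 := by
    have : (A ^ p).natDegree ≤ p := by
      rw [natDegree_le_iff_coeff_eq_zero]
      intro j hj
      rw [← h2]
      apply h (p * N, j)
      intro he
      rw [Prod.mk.injEq] at he
      omega
    rw [natDegree_pow] at this
    exact Nat.le_of_mul_le_mul_left (by omega) hp
  obtain ⟨i, j⟩ := m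
  rw [cf_def]
  by_cases hi : i = 0
  · subst hi
    have hj : 1 < j := by
      have : j ≠ 0 := by rintro rfl; exact hm rfl
      have : j ≠ 1 := by rintro rfl; exact hm' rfl
      omega
    rw [hN0] at hA
    simp only
    rw [← hA, coeff_eq_zero_of_natDegree_lt (by omega)]
  · simp only
    rw [coeff_eq_zero_of_natDegree_lt (n := i) (by omega), coeff_zero]

end Deg

section Sig
variable {R B : Type} [CommRing R] [CommRing B] [Algebra R B] {p : ℕ}

theorem sig_map (a : Weyl R) : (wSig B (wMap R B a)).unop = wMap R B (wSig R a).unop := by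
  have : ((wSig B).restrictScalars R).comp (wMap R B) = ((AlgHom.op (wMap R B))).comp (wSig R) := by
    apply w_hom_ext
    · simp [wMap, wSig]
    · simp [wMap, wSig]
  have := congrArg (fun f => (f a).unop) this
  simpa using this

theorem neg_pow_aux {A : Type} [Ring A] [Algebra B A] (hodd : Odd p) (y : A) : (-y) ^ p = (-1 : B) • y ^ p := by
  rw [neg_one_smul]; exact hodd.neg_pow _

theorem sig_coef [hp : Fact p.Prime] [CharP B p] (hp2 : p ≠ 2) (T S : Weyl B) (h : T * S = S * T + 1)
    (hT : (wSig B T).unop = -T) (k : ℕ) : 2 * cf (p * k, 0) (T ^ p) = 0 := by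
  have hp0 := hp.out.pos
  have hodd : Odd p := hp.out.odd_of_ne_two hp2
  have hTc : T ^ p ∈ Subring.center (Weyl B) := by
    apply w_pow_central (T := -S)
    exact neg_rel3 h
  obtain ⟨F0, hF0, -⟩ := w_repr (T ^ p)
  have hrep := center_repr hTc (F0.image (fun m => (m.1 / p, m.2 / p))) (by
    intro m hm
    apply hF0
    intro hh
    apply hm
    rw [Finset.mem_image]
    exact ⟨_, hh, by simp [Nat.mul_div_cancel_left _ hp0]⟩)
  have hsp : (wSig B (T ^ p)).unop = - T ^ p := by
    rw [map_pow, MulOpposite.unop_pow, hT]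
    exact hodd.neg_pow T
  have hsm : ∀ i j : ℕ, (wSig B ((Wx B ^ p) ^ i * (Wy B ^ p) ^ j)).unop = ((-1 : B) ^ j) • ((Wx B ^ p) ^ i * (Wy B ^ p) ^ j) := by
    intro i j
    have hYc : Wy B ^ p ∈ Subring.center (Weyl B) := wy_pow_central
    have e1 : wSig B (Wx B) = MulOpposite.op (Wx B) := by simp [wSig]
    have e2 : wSig B (Wy B) = MulOpposite.op (-Wy B) := by simp [wSig]
    rw [map_mul, map_pow, map_pow, map_pow, map_pow, e1, e2, MulOpposite.unop_mul]
    simp only [MulOpposite.unop_pow, MulOpposite.unop_op]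
    have e3 : (-Wy B) ^ p = (-1 : B) • Wy B ^ p := neg_pow_aux hodd _
    rw [e3, smul_pow, smul_mul_assoc, ((Subring.mem_center_iff.1 (Subring.pow_mem _ hYc j)) _)]
  let sg : Weyl B →ₗ[B] Weyl B := (MulOpposite.opLinearEquiv B).symm.toLinearMap ∘ₗ (wSig B).toLinearMap
  have hsp' : sg (T ^ p) = - T ^ p := hsp
  have hsm' : ∀ i j : ℕ, sg ((Wx B ^ p) ^ i * (Wy B ^ p) ^ j) = ((-1 : B) ^ j) • ((Wx B ^ p) ^ i * (Wy B ^ p) ^ j) := hsm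
  have h3 := congrArg (fun z => cf (p * k, 0) (sg z)) hrep
  simp only [hsp', map_sum, map_smul, hsm'] at h3
  have h4 := congrArg (fun z => cf (p * k, 0) z) hrep
  simp only [map_sum, map_smul] at h4
  have h5 : cf (p * k, 0) (- T ^ p) = cf (p * k, 0) (T ^ p) := by
    rw [h3]
    conv_rhs => rw [h4]
    apply Finset.sum_congr rfl
    intro m _
    congr 1
    rw [← mon_pp, cf_mon]
    split_ifs with hh
    · rw [Prod.mk.injEq] at hh
      have : m.2 = 0 := by
        rcases Nat.mul_eq_zero.1 hh.2.symm with h | h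
        · omega
        · exact h
      simp [this]
    · simp
  rw [map_neg] at h5
  linear_combination -h5

end Sig

section Classical
variable {k : Type} [Field k] {p : ℕ} [CharP k p]

theorem single_term (F : Finset (ℕ × ℕ)) (s t : ℕ × ℕ → k) (n m0 m0' : ℕ × ℕ)
    (hm0 : m0 ∈ F) (hm0' : m0' ∈ F) (hn : m0 + m0' = n)
    (h : ∀ m m', s m ≠ 0 → t m' ≠ 0 → m + m' = n → m = m0 ∧ m' = m0') :
    (∑ m ∈ F, ∑ m' ∈ F, (if m + m' = n then
      ((m.1 : k) * m'.2 - m.2 * m'.1) * (s m * t m') else 0)) =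
      ((m0.1 : k) * m0'.2 - m0.2 * m0'.1) * (s m0 * t m0') := by
  have hz : ∀ m m', (m ≠ m0 ∨ m' ≠ m0') → (if m + m' = n then
      ((m.1 : k) * m'.2 - m.2 * m'.1) * (s m * t m') else 0) = 0 := by
    intro m m' hne
    split_ifs with he
    · by_cases h1 : s m = 0
      · rw [h1]; ring
      by_cases h2 : t m' = 0
      · rw [h2]; ring
      obtain ⟨a, b⟩ := h m m' h1 h2 he
      rcases hne with hne | hne
      · exact absurd a hne
      · exact absurd b hne
    · rfl
  rw [Finset.sum_eq_single_of_mem m0 hm0, Finset.sum_eq_single_of_mem m0' hm0', if_pos hn]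
  · intro m' _ hne
    exact hz _ _ (Or.inr hne)
  · intro m _ hne
    apply Finset.sum_eq_zero
    intro m' _
    exact hz _ _ (Or.inl hne)

theorem cast_ne {n : ℕ} (h0 : 0 < n) (h1 : n < p) : (n : k) ≠ 0 := by
  rw [Ne, CharP.cast_eq_zero_iff k p]
  exact Nat.not_dvd_of_pos_of_lt h0 h1

theorem classical_lem (N : ℕ) (hN : 2 * N + 2 < p) (s t : ℕ × ℕ → k) (F : Finset (ℕ × ℕ))
    (hF : F = Finset.range (N + 1) ×ˢ Finset.range (N + 1))
    (hs : ∀ m, m ∉ F → s m = 0) (ht : ∀ m, m ∉ F → t m = 0) (ht0 : ∀ i, t (i, 0) = 0)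
    (hI : ∀ n : ℕ × ℕ, (∑ m ∈ F, ∑ m' ∈ F, (if m + m' = n then
      ((m.1 : k) * m'.2 - m.2 * m'.1) * (s m * t m') else 0)) = if n = (1, 1) then 1 else 0)
    (m1 : ℕ × ℕ) (hm1 : m1 ≠ (0, 1)) : t m1 = 0 := by
  classical
  have hs' : ∀ m, s m ≠ 0 → m ∈ F := fun m h => by by_contra hh; exact h (hs m hh)
  have ht' : ∀ m, t m ≠ 0 → m ∈ F := fun m h => by by_contra hh; exact h (ht m hh)
  have hb : ∀ m, m ∈ F → m.1 ≤ N ∧ m.2 ≤ N := by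
    intro m hm
    rw [hF, Finset.mem_product, Finset.mem_range, Finset.mem_range] at hm
    omega
  have ht2 : ∀ m, t m ≠ 0 → 1 ≤ m.2 := by
    rintro ⟨a, b⟩ h
    by_contra hh
    simp only at hh
    have : b = 0 := by omega
    subst this
    exact h (ht0 a)
  -- the basic elements
  have hbase : s (1, 0) ≠ 0 ∧ t (0, 1) ≠ 0 := by
    have h1 := hI (1, 1)
    rw [if_pos rfl] at h1
    have h2 : (∑ m ∈ F, ∑ m' ∈ F, (if m + m' = (1, 1) then
      ((m.1 : k) * m'.2 - m.2 * m'.1) * (s m * t m') else 0)) ≠ 0 := by rw [h1]; exact one_ne_zero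
    obtain ⟨m, -, h3⟩ := Finset.exists_ne_zero_of_sum_ne_zero h2
    obtain ⟨m', -, h4⟩ := Finset.exists_ne_zero_of_sum_ne_zero h3
    have he : m + m' = (1, 1) := by
      by_contra hh
      rw [if_neg hh] at h4; exact h4 rfl
    rw [if_pos he] at h4
    have hsm : s m ≠ 0 := fun h => h4 (by rw [h]; ring)
    have htm : t m' ≠ 0 := fun h => h4 (by rw [h]; ring)
    have hl := ht2 _ htm
    obtain ⟨i, j⟩ := m
    obtain ⟨a, b⟩ := m'
    simp only [Prod.mk_add_mk, Prod.mk.injEq] at he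
    simp only at hl
    have hj : j = 0 := by omega
    have hb1 : b = 1 := by omega
    subst hj hb1
    have hi : i ≠ 0 := by
      rintro rfl
      apply h4; simp
    have : i = 1 := by omega
    have : a = 0 := by omega
    subst i; subst a
    exact ⟨hsm, htm⟩
  -- part (a)
  have hA : (∀ i, s (i, 0) ≠ 0 → i ≤ 1) ∧ (∀ i, t (i, 1) ≠ 0 → i = 0) := by
    obtain ⟨m0, hm0, hmax⟩ := Finset.exists_max_image (F.filter (fun m => m.2 = 0 ∧ s m ≠ 0)) (fun m => m.1)
      ⟨(1, 0), Finset.mem_filter.2 ⟨hs' _ hbase.1, rfl, hbase.1⟩⟩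
    obtain ⟨m0', hm0', hmax'⟩ := Finset.exists_max_image (F.filter (fun m => m.2 = 1 ∧ t m ≠ 0)) (fun m => m.1)
      ⟨(0, 1), Finset.mem_filter.2 ⟨ht' _ hbase.2, rfl, hbase.2⟩⟩
    rw [Finset.mem_filter] at hm0 hm0'
    obtain ⟨hF0, hj0, hs0⟩ := hm0
    obtain ⟨hF0', hl0, ht0'⟩ := hm0'
    have hmaxs : ∀ i, s (i, 0) ≠ 0 → i ≤ m0.1 := fun i hi =>
      hmax (i, 0) (Finset.mem_filter.2 ⟨hs' _ hi, rfl, hi⟩)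
    have hmaxt : ∀ i, t (i, 1) ≠ 0 → i ≤ m0'.1 := fun i hi =>
      hmax' (i, 1) (Finset.mem_filter.2 ⟨ht' _ hi, rfl, hi⟩)
    have hge := hmaxs 1 hbase.1
    have h1 := single_term F s t (m0 + m0') m0 m0' hF0 hF0' rfl (by
      intro m m' hsm htm he
      have hl := ht2 _ htm
      obtain ⟨i, j⟩ := m
      obtain ⟨a, b⟩ := m'
      rw [Prod.ext_iff] at he
      simp only [Prod.fst_add, Prod.snd_add] at he hl
      have hj : j = 0 := by omega
      have hb1 : b = 1 := by omega
      subst hj hb1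
      have := hmaxs i hsm
      have := hmaxt a htm
      constructor
      · ext <;> simp only <;> omega
      · ext <;> simp only <;> omega)
    rw [hI, hj0, hl0] at h1
    have hc : (m0.1 : k) ≠ 0 := cast_ne (p := p) (by omega) (by have := hb _ hF0; omega)
    split_ifs at h1 with hn
    · rw [Prod.ext_iff] at hn
      simp only [Prod.fst_add, Prod.snd_add] at hn
      constructor
      · intro i hi; have := hmaxs i hi; omega
      · intro i hi; have := hmaxt i hi; omega
    · exfalso
      have : (m0.1 : k) * (s m0 * t m0') = 0 := by rw [h1]; push_cast; ring
      exact mul_ne_zero hc (mul_ne_zero hs0 ht0') this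
  -- part (b)
  by_contra hne
  have hm12 : 2 ≤ m1.2 := by
    have h1 := ht2 _ hne
    by_contra hh
    have h2 : m1.2 = 1 := by omega
    have h3 : m1 = (m1.1, 1) := Prod.ext rfl h2
    rw [h3] at hne
    have := hA.2 _ hne
    exact hm1 (Prod.ext this h2)
  let G : Finset (ℤ × ℤ) := (F.filter (fun m => 1 ≤ m.2 ∧ s m ≠ 0)).image (fun m => ((m.1 : ℤ) - 1, (m.2 : ℤ))) ∪
    (F.filter (fun m => 2 ≤ m.2 ∧ t m ≠ 0)).image (fun m => ((m.1 : ℤ), (m.2 : ℤ) - 1))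
  have hGs : ∀ m : ℕ × ℕ, 1 ≤ m.2 → s m ≠ 0 → ((m.1 : ℤ) - 1, (m.2 : ℤ)) ∈ G := by
    intro m h1 h2
    exact Finset.mem_union_left _ (Finset.mem_image.2 ⟨m, Finset.mem_filter.2 ⟨hs' _ h2, h1, h2⟩, rfl⟩)
  have hGt : ∀ m : ℕ × ℕ, 2 ≤ m.2 → t m ≠ 0 → ((m.1 : ℤ), (m.2 : ℤ) - 1) ∈ G := by
    intro m h1 h2
    exact Finset.mem_union_right _ (Finset.mem_image.2 ⟨m, Finset.mem_filter.2 ⟨ht' _ h2, h1, h2⟩, rfl⟩)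
  have hGy : ∀ g ∈ G, 1 ≤ g.2 := by
    intro g hg
    rcases Finset.mem_union.1 hg with hg | hg
    · obtain ⟨m, hm, rfl⟩ := Finset.mem_image.1 hg
      have := (Finset.mem_filter.1 hm).2.1
      simp only; omega
    · obtain ⟨m, hm, rfl⟩ := Finset.mem_image.1 hg
      have := (Finset.mem_filter.1 hm).2.1
      simp only; omega
  obtain ⟨g, hg, hgmax⟩ := Finset.exists_max_image G (fun g => (g.1 : ℚ) / g.2) ⟨_, hGt m1 hm12 hne⟩
  have hy := hGy g hg
  have hmax : ∀ g' ∈ G, g'.1 * g.2 ≤ g.1 * g'.2 := by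
    intro g' hg'
    have h1 := hgmax g' hg'
    have hy' := hGy g' hg'
    rw [div_le_div_iff₀ (by exact_mod_cast hy') (by exact_mod_cast hy)] at h1
    exact_mod_cast h1
  obtain ⟨x, y⟩ := g
  simp only at hy hmax
  have hx : 0 ≤ x := by
    have h1 := hmax _ (hGt m1 hm12 hne)
    simp only at h1
    by_contra hh
    have h2 : 0 ≤ (m1.1 : ℤ) * y := by positivity
    have h3 : x * ((m1.2 : ℤ) - 1) < 0 := by
      apply mul_neg_of_neg_of_pos <;> omega
    omega
  have hls : ∀ m, s m ≠ 0 → ((m.1 : ℤ) - 1) * y ≤ x * m.2 := by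
    intro m hm
    by_cases h1 : 1 ≤ m.2
    · exact hmax _ (hGs m h1 hm)
    · have h2 : m.2 = 0 := by omega
      have h3 : m = (m.1, 0) := Prod.ext rfl h2
      rw [h3] at hm
      have h4 := hA.1 _ hm
      rw [h2]
      have : ((m.1 : ℤ) - 1) * y ≤ 0 := mul_nonpos_of_nonpos_of_nonneg (by omega) (by omega)
      simpa using this
  have hlt : ∀ m, t m ≠ 0 → (m.1 : ℤ) * y ≤ x * ((m.2 : ℤ) - 1) := by
    intro m hm
    have h0 := ht2 m hm
    by_cases h1 : 2 ≤ m.2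
    · exact hmax _ (hGt m h1 hm)
    · have h2 : m.2 = 1 := by omega
      have h3 : m = (m.1, 1) := Prod.ext rfl h2
      rw [h3] at hm
      have h4 := hA.2 _ hm
      rw [h2, h4]; simp
  obtain ⟨m0, hm0, hmaxs⟩ := Finset.exists_max_image
    (F.filter (fun m => ((m.1 : ℤ) - 1) * y = x * m.2 ∧ s m ≠ 0)) (fun m => m.2)
      ⟨(1, 0), Finset.mem_filter.2 ⟨hs' _ hbase.1, by simp, hbase.1⟩⟩
  obtain ⟨m0', hm0', hmaxt⟩ := Finset.exists_max_image
    (F.filter (fun m => (m.1 : ℤ) * y = x * ((m.2 : ℤ) - 1) ∧ t m ≠ 0)) (fun m => m.2)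
      ⟨(0, 1), Finset.mem_filter.2 ⟨ht' _ hbase.2, by simp, hbase.2⟩⟩
  rw [Finset.mem_filter] at hm0 hm0'
  obtain ⟨hF0, hl0, hs0⟩ := hm0
  obtain ⟨hF0', hl0', ht0'⟩ := hm0'
  have hmaxs' : ∀ m : ℕ × ℕ, ((m.1 : ℤ) - 1) * y = x * m.2 → s m ≠ 0 → m.2 ≤ m0.2 := fun m h1 h2 =>
    hmaxs m (Finset.mem_filter.2 ⟨hs' _ h2, h1, h2⟩)
  have hmaxt' : ∀ m : ℕ × ℕ, (m.1 : ℤ) * y = x * ((m.2 : ℤ) - 1) → t m ≠ 0 → m.2 ≤ m0'.2 := fun m h1 h2 =>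
    hmaxt m (Finset.mem_filter.2 ⟨ht' _ h2, h1, h2⟩)
  have h1 := single_term F s t (m0 + m0') m0 m0' hF0 hF0' rfl (by
    intro m m' hsm htm he
    rw [Prod.ext_iff] at he
    simp only [Prod.fst_add, Prod.snd_add] at he
    have e1 : (m.1 : ℤ) + m'.1 = m0.1 + m0'.1 := by exact_mod_cast he.1
    have e2 : (m.2 : ℤ) + m'.2 = m0.2 + m0'.2 := by exact_mod_cast he.2
    have i1 := hls m hsm
    have i2 := hlt m' htm
    have i3 : (((m.1 : ℤ) - 1) * y - x * m.2) + ((m'.1 : ℤ) * y - x * ((m'.2 : ℤ) - 1)) = 0 := by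
      linear_combination y * e1 - x * e2 + hl0 + hl0'
    have j1 : ((m.1 : ℤ) - 1) * y = x * m.2 := by linarith
    have j2 : (m'.1 : ℤ) * y = x * ((m'.2 : ℤ) - 1) := by linarith
    have k1 := hmaxs' m j1 hsm
    have k2 := hmaxt' m' j2 htm
    have q1 : m.2 = m0.2 := by omega
    have q2 : m'.2 = m0'.2 := by omega
    have q3 : (m.1 : ℤ) = m0.1 := by
      have : ((m.1 : ℤ) - m0.1) * y = 0 := by
        rw [q1] at j1; linear_combination j1 - hl0
      rcases mul_eq_zero.1 this with h | h <;> omega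
    have q3' : m.1 = m0.1 := by exact_mod_cast q3
    exact ⟨Prod.ext q3' q1, Prod.ext (by omega) q2⟩)
  have hl1 := ht2 _ ht0'
  have hi1 : 1 ≤ m0.1 := by
    by_contra hh
    have h2 : m0.1 = 0 := by omega
    rw [h2] at hl0
    have : 0 ≤ x * (m0.2 : ℤ) := by positivity
    rw [← hl0] at this
    simp at this
    omega
  have hco : (m0.1 : ℤ) * m0'.2 - m0.2 * m0'.1 = ((m0'.2 + m0.1 - 1 : ℕ) : ℤ) := by
    rw [Nat.cast_sub (by omega)]
    push_cast
    have : y * ((m0.1 : ℤ) * m0'.2 - m0.2 * m0'.1 - (m0'.2 + m0.1 - 1)) = 0 := by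
      linear_combination ((m0'.2 : ℤ) - 1) * hl0 - (m0.2 : ℤ) * hl0'
    rcases mul_eq_zero.1 this with h | h
    · omega
    · linarith
  have hco' : (m0.1 : k) * m0'.2 - m0.2 * m0'.1 = ((m0'.2 + m0.1 - 1 : ℕ) : k) := by
    have := congrArg (fun z : ℤ => (z : k)) hco
    push_cast at this
    exact_mod_cast this
  rw [hI, hco'] at h1
  have hb1 := hb _ hF0
  have hb2 := hb _ hF0'
  split_ifs at h1 with hn
  · rw [Prod.ext_iff] at hn
    simp only [Prod.fst_add, Prod.snd_add] at hn
    rcases Finset.mem_union.1 hg with hg | hg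
    · obtain ⟨m, hm, he⟩ := Finset.mem_image.1 hg
      obtain ⟨-, c1, c2⟩ := Finset.mem_filter.1 hm
      rw [Prod.mk.injEq] at he
      have := hmaxs' m (by rw [← he.1, ← he.2]) c2
      omega
    · obtain ⟨m, hm, he⟩ := Finset.mem_image.1 hg
      obtain ⟨-, c1, c2⟩ := Finset.mem_filter.1 hm
      rw [Prod.mk.injEq] at he
      have := hmaxt' m (by rw [← he.1, ← he.2]) c2
      omega
  · exact mul_ne_zero (cast_ne (p := p) (by omega) (by omega)) (mul_ne_zero hs0 ht0') h1.symm

end Classical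

section ModP

theorem Bd.map {R B : Type} [CommRing R] [CommRing B] [Algebra R B] {N M : ℕ} {a : Weyl R} (h : Bd N M a) :
    Bd N M (wMap R B a) := by
  intro m hm
  rw [cf_map, h m hm, map_zero]

theorem rel_map {R B : Type} [CommRing R] [CommRing B] [Algebra R B] {S T : Weyl R} (h : T * S = S * T + 1) :
    wMap R B T * wMap R B S = wMap R B S * wMap R B T + 1 := by
  rw [← map_mul, h, map_add, map_mul, map_one]

theorem modp_aux {R B k : Type} [CommRing R] [CommRing B] [Field k] [Algebra R B] [Algebra B k] {p : ℕ}
    [hp : Fact p.Prime] [CharP B p] [CharP k p] (hs : Function.Surjective (algebraMap R B))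
    (hk : ∀ r, algebraMap R B r = 0 → ∃ b, r = (p : R) * b)
    (ht : ∀ a : R, (p : R) * a = 0 → a = 0)
    (S T : Weyl R) (h : T * S = S * T + 1) (hσ : (wSig R T).unop = -T) (N : ℕ) (hN : 2 * N + 2 < p)
    (hS : Bd N N S) (hT : Bd N N T) (m : ℕ × ℕ) (hm : m ≠ (0, 0)) (hm' : m ≠ (0, 1)) :
    algebraMap B k (algebraMap R B (cf m T)) = 0 := by
  have hp0 := hp.out.pos
  rw [← cf_map, ← cf_map]
  have hB := rel_map (B := B) h
  have hK := rel_map (B := k) hB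
  set F := Finset.range (N + 1) ×ˢ Finset.range (N + 1) with hF
  have hFb : ∀ a : Weyl B, Bd N N a → ∀ m, m ∉ F → cf (p * m.1, p * m.2) (a ^ p) = 0 := by
    intro a ha m hm
    apply ha.pow p
    rw [hF, Finset.mem_product, Finset.mem_range, Finset.mem_range] at hm
    simp only [Nat.mul_lt_mul_left hp0]
    omega
  have hSF := hFb _ hS.map
  have hTF := hFb _ hT.map
  have hco := coef_identity hs hk ht S T h F hSF hTF
  have hfac : (((p - 1).factorial : ℕ) : k) ≠ 0 := by
    rw [Ne, CharP.cast_eq_zero_iff k p, hp.out.dvd_factorial]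
    omega
  have h2 : (2 : k) ≠ 0 := by
    have := cast_ne (k := k) (p := p) (n := 2) (by norm_num) (by omega)
    exact_mod_cast this
  have hTc : wMap B k (wMap R B T) ^ p ∈ Subring.center (Weyl k) := by
    apply w_pow_central (T := -wMap B k (wMap R B S))
    exact neg_rel3 hK
  have hcl := classical_lem (k := k) N hN
    (fun m => algebraMap B k (cf (p * m.1, p * m.2) (wMap R B S ^ p)))
    (fun m => algebraMap B k (cf (p * m.1, p * m.2) (wMap R B T ^ p))) F hF
    (fun m hm => by rw [hSF m hm, map_zero]) (fun m hm => by rw [hTF m hm, map_zero])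
    (by
      intro i
      have := sig_coef (by omega) (wMap R B T) (wMap R B S) hB (by rw [sig_map, hσ, map_neg]) i
      have := congrArg (algebraMap B k) this
      rw [map_mul, map_ofNat, map_zero] at this
      exact (mul_eq_zero.1 this).resolve_left h2)
    (by
      intro n
      have := congrArg (algebraMap B k) (hco n)
      rw [map_mul, map_mul, map_natCast] at this
      have := mul_left_cancel₀ hfac this
      rw [map_sum] at this
      simp only [map_sum, apply_ite (algebraMap B k), map_mul, map_sub, map_natCast, map_one, map_zero] at this
      exact this)
  apply root_Y hp0 _ _ m hm hm'
  intro n hn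
  by_cases hd : p ∣ n.1 ∧ p ∣ n.2
  · obtain ⟨⟨i, hi⟩, ⟨j, hj⟩⟩ := hd
    have hn2 : n = (p * i, p * j) := Prod.ext hi hj
    have := hcl (i, j) (by
      intro he
      rw [Prod.mk.injEq] at he
      apply hn
      rw [hn2, he.1, he.2, mul_zero, mul_one])
    simp only at this
    rw [hn2, ← map_pow, cf_map]
    exact this
  · exact cf_central hTc n hd

theorem modp {R k : Type} [CommRing R] [Field k] [Algebra R k] {p : ℕ}
    [hp : Fact p.Prime] [CharP k p]
    (ht : ∀ a : R, (p : R) * a = 0 → a = 0)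
    (S T : Weyl R) (h : T * S = S * T + 1) (hσ : (wSig R T).unop = -T) (N : ℕ) (hN : 2 * N + 2 < p)
    (hS : Bd N N S) (hT : Bd N N T) (m : ℕ × ℕ) (hm : m ≠ (0, 0)) (hm' : m ≠ (0, 1)) :
    algebraMap R k (cf m T) = 0 := by
  let I := Ideal.span {(p : R)}
  let φ : R ⧸ I →+* k := Ideal.Quotient.lift I (algebraMap R k) (by
    intro a ha
    obtain ⟨b, rfl⟩ := Ideal.mem_span_singleton.1 ha
    rw [map_mul, map_natCast, CharP.cast_eq_zero, zero_mul])
  let _ : Algebra (R ⧸ I) k := φ.toAlgebra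
  have : Nontrivial (R ⧸ I) := φ.domain_nontrivial
  have : CharP (R ⧸ I) p := by
    rw [CharP.charP_iff_prime_eq_zero hp.out]
    rw [← map_natCast (Ideal.Quotient.mk I), Ideal.Quotient.eq_zero_iff_mem]
    exact Ideal.mem_span_singleton_self _
  exact modp_aux (B := R ⧸ I) (k := k) Ideal.Quotient.mk_surjective (by
    intro r hr
    exact Ideal.mem_span_singleton.1 (Ideal.Quotient.eq_zero_iff_mem.1 hr)) ht S T h hσ N hN hS hT m hm hm'

end ModP

section Spec

theorem wMap_inj {R B : Type} [CommRing R] [CommRing B] [Algebra R B] (h : Function.Injective (algebraMap R B)) :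
    Function.Injective (wMap R B) := by
  intro a b hab
  apply w_ext
  intro m
  apply h
  rw [← cf_map, ← cf_map, hab]

theorem w_lift {K : Type} [Field K] (A : Subalgebra ℤ K) (a : Weyl K) (F : Finset (ℕ × ℕ))
    (hF : ∀ m, m ∉ F → cf m a = 0) (hA : ∀ m ∈ F, cf m a ∈ A) : ∃ a0 : Weyl A, wMap A K a0 = a := by
  have hall : ∀ m, cf m a ∈ A := by
    intro m
    by_cases hm : m ∈ F
    · exact hA m hm
    · rw [hF m hm]; exact A.zero_mem
  refine ⟨∑ m ∈ F, (⟨cf m a, hall m⟩ : A) • mon A m, ?_⟩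
  conv_rhs => rw [w_repr' a F hF]
  rw [map_sum]
  apply Finset.sum_congr rfl
  intro m _
  rw [map_smul, wMap_mon, ← algebraMap_smul K (_ : A)]
  rfl

theorem int_jac : IsJacobsonRing ℤ := by
  rw [isJacobsonRing_iff_prime_eq]
  intro P hP
  by_cases hb : P = ⊥
  · subst hb
    rw [eq_bot_iff]
    intro x hx
    rw [Ideal.mem_jacobson_bot] at hx
    by_contra h0
    have hx0 : x ≠ 0 := fun h => h0 (by simp [h])
    have h1 := hx (3 * x)
    have h2 : 0 < x * x := mul_self_pos.2 hx0
    rcases Int.isUnit_iff.1 h1 with h | h <;> nlinarith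
  · have : P.IsMaximal := Ideal.IsPrime.isMaximal hP hb
    exact Ideal.jacobson_eq_self_of_isMaximal

theorem spec_main {K : Type} [Field K] [CharZero K] (S T : Weyl K) (h : T * S = S * T + 1)
    (hσ : (wSig K T).unop = -T) (m0 : ℕ × ℕ) (hm : m0 ≠ (0, 0)) (hm' : m0 ≠ (0, 1)) : cf m0 T = 0 := by
  classical
  by_contra ha
  obtain ⟨F1, hF1, -⟩ := w_repr S
  obtain ⟨F2, hF2, -⟩ := w_repr T
  let N := (F1 ∪ F2).sup (fun m => max m.1 m.2)
  have hNle : ∀ m ∈ F1 ∪ F2, m.1 ≤ N ∧ m.2 ≤ N := by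
    intro m hm
    have : max m.1 m.2 ≤ N := Finset.le_sup (f := fun m : ℕ × ℕ => max m.1 m.2) hm
    omega
  let M := 2 * N + 2
  let E : Finset K := F1.image (fun m => cf m S) ∪ F2.image (fun m => cf m T) ∪ {(cf m0 T)⁻¹, ((M.factorial : ℕ) : K)⁻¹}
  let A := Algebra.adjoin ℤ (E : Set K)
  have hE : ∀ x ∈ E, x ∈ A := fun x hx => Algebra.subset_adjoin hx
  have hinj : Function.Injective (algebraMap A K) := Subtype.val_injective
  obtain ⟨S0, hS0⟩ := w_lift A S F1 hF1 (fun m hm => hE _ (by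
    apply Finset.mem_union_left; apply Finset.mem_union_left; exact Finset.mem_image_of_mem _ hm))
  obtain ⟨T0, hT0⟩ := w_lift A T F2 hF2 (fun m hm => hE _ (by
    apply Finset.mem_union_left; apply Finset.mem_union_right; exact Finset.mem_image_of_mem _ hm))
  have ha1 : (cf m0 T)⁻¹ ∈ A := hE _ (by apply Finset.mem_union_right; simp)
  have ha2 : ((M.factorial : ℕ) : K)⁻¹ ∈ A := hE _ (by apply Finset.mem_union_right; simp)
  have hft : Algebra.FiniteType ℤ A := (Subalgebra.fg_iff_finiteType A).1 (Subalgebra.fg_adjoin_finset E)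
  obtain ⟨I, hI⟩ := Ideal.exists_maximal A
  let _ : Field (A ⧸ I) := Ideal.Quotient.field I
  have hft2 : Algebra.FiniteType ℤ (A ⧸ I) :=
    Algebra.FiniteType.of_surjective (Ideal.Quotient.mkₐ ℤ I) (Ideal.Quotient.mkₐ_surjective ℤ I)
  have := int_jac
  have hfin : Module.Finite ℤ (A ⧸ I) := finite_of_finite_type_of_isJacobsonRing ℤ (A ⧸ I)
  obtain ⟨p, hpc⟩ := CharP.exists (A ⧸ I)
  have hp : p.Prime := by
    rcases CharP.char_is_prime_or_zero (A ⧸ I) p with h | h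
    · exact h
    · subst h
      have : CharZero (A ⧸ I) := CharP.charP_to_charZero _
      exfalso
      apply Int.not_isField
      refine isField_of_isIntegral_of_isField (S := A ⧸ I) ?_ (Field.toIsField _)
      exact (algebraMap ℤ (A ⧸ I)).injective_int
  have hpf : Fact p.Prime := ⟨hp⟩
  have hMp : M < p := by
    by_contra hh
    have h1 : p ∣ M.factorial := hp.dvd_factorial.2 (by omega)
    have h2 : ((M.factorial : ℕ) : A ⧸ I) = 0 := (CharP.cast_eq_zero_iff _ p _).2 h1
    have h3 : ((M.factorial : ℕ) : A) * ⟨_, ha2⟩ = 1 := by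
      apply Subtype.ext
      push_cast
      exact mul_inv_cancel₀ (Nat.cast_ne_zero.2 (Nat.factorial_ne_zero M))
    have h4 := congrArg (Ideal.Quotient.mk I) h3
    rw [map_mul, map_natCast, h2, zero_mul, map_one] at h4
    exact zero_ne_one h4
  have hbd : ∀ (a : Weyl K) (a0 : Weyl A), wMap A K a0 = a → (∀ m, m ∉ F1 ∪ F2 → cf m a = 0) → Bd N N a0 := by
    intro a a0 h1 h2 m hm
    apply hinj
    rw [← cf_map, h1, map_zero]
    apply h2
    intro hh
    have := hNle m hh
    omega
  have key := modp (R := A) (k := A ⧸ I) (p := p) (by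
      intro a h
      apply hinj
      have := congrArg (algebraMap A K) h
      rw [map_mul, map_natCast, map_zero] at this
      rw [map_zero]
      exact (mul_eq_zero.1 this).resolve_left (Nat.cast_ne_zero.2 hp.ne_zero)) S0 T0
    (by
      apply wMap_inj hinj
      rw [map_mul, map_add, map_mul, map_one, hS0, hT0, h])
    (by
      apply wMap_inj hinj
      rw [← sig_map, hT0, hσ, map_neg, hT0]) N hMp
    (hbd S S0 hS0 (fun m hm => hF1 m (fun h => hm (Finset.mem_union_left _ h))))
    (hbd T T0 hT0 (fun m hm => hF2 m (fun h => hm (Finset.mem_union_right _ h)))) m0 hm hm'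
  have h3 : cf m0 T0 * ⟨_, ha1⟩ = 1 := by
    apply hinj
    rw [map_mul, ← cf_map, hT0, map_one]
    exact mul_inv_cancel₀ ha
  have h4 := congrArg (algebraMap A (A ⧸ I)) h3
  rw [map_mul, key, zero_mul, map_one] at h4
  exact zero_ne_one h4

end Spec

section Final

theorem f_inj {K : Type} [Field K] [CharZero K] (f : Weyl K →ₐ[K] Weyl K) : Function.Injective f := by
  classical
  rw [injective_iff_map_eq_zero]
  intro a ha
  obtain ⟨F, hF, -⟩ := w_repr a
  apply w_ext
  intro m
  let n := (insert m F).sup (fun m => max m.1 m.2) + 1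
  have hn : ∀ k ∈ insert m F, k.1 < n ∧ k.2 < n := by
    intro k hk
    have : max k.1 k.2 ≤ (insert m F).sup (fun m => max m.1 m.2) :=
      Finset.le_sup (f := fun m : ℕ × ℕ => max m.1 m.2) hk
    omega
  let I : AddSubgroup (Weyl K) := (f : Weyl K →+ Weyl K).ker
  have hI : ∀ x, x ∈ I ↔ f x = 0 := fun x => Iff.rfl
  have key := ad_indep2 I (wy_wx K) (by intro a x hx; rw [hI] at *; rw [map_mul, hx, mul_zero])
    (by intro a x hx; rw [hI] at *; rw [map_mul, hx, zero_mul]) n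
    (by
      intro i hi _ x hx
      rw [hI] at *
      have h1 : ((i : Weyl K)) * x = (i : K) • x := by
        rw [Algebra.smul_def, map_natCast]
      rw [h1, map_smul] at hx
      exact (smul_eq_zero.1 hx).resolve_left (by exact_mod_cast hi.ne'))
    (fun i j => algebraMap K (Weyl K) (cf (i, j) a)) (fun i j b => (Algebra.commutes _ b).symm)
    (by
      rw [hI, ← Finset.sum_product', ← ha]
      congr 1
      conv_rhs => rw [w_repr' a (Finset.range n ×ˢ Finset.range n) (by
        intro k hk
        apply hF
        intro hk'
        apply hk
        have := hn k (Finset.mem_insert_of_mem hk')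
        simp [this.1, this.2])]
      apply Finset.sum_congr rfl
      intro k _
      rw [Algebra.smul_def]
      rfl)
    m.1 (hn m (Finset.mem_insert_self _ _)).1 m.2 (hn m (Finset.mem_insert_self _ _)).2
  rw [hI, AlgHom.commutes] at key
  have := w_algebraMap_inj (key.trans (map_zero _).symm)
  rw [map_zero]
  exact this

theorem ab_aux {K A : Type} [Field K] [Ring A] [Algebra K A] (b : K) (hb : b ≠ 0) (c : K) (X Y S : A)
    (h : Y * X = X * Y + 1) (hT : (c • 1 + b • Y) * S = S * (c • 1 + b • Y) + 1) :
    Y * (S - b⁻¹ • X) - (S - b⁻¹ • X) * Y = 0 := by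
  have h1 : b • (Y * S) = b • (S * Y) + 1 := by
    simp only [add_mul, mul_add, smul_mul_assoc, mul_smul_comm, one_mul, mul_one] at hT
    rw [add_assoc] at hT
    exact add_left_cancel hT
  have h2 : Y * S = S * Y + b⁻¹ • (1 : A) := by
    have := congrArg (fun z => b⁻¹ • z) h1
    simpa [smul_smul, inv_mul_cancel₀ hb, smul_add] using this
  rw [mul_sub, sub_mul, h2, mul_smul_comm, smul_mul_assoc, h, smul_add]
  abel

theorem f_surj {K : Type} [Field K] [CharZero K] (f : Weyl K →ₐ[K] Weyl K)
    (hσ : (wSig K (f (Wy K))).unop = -f (Wy K)) : Function.Surjective f := by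
  classical
  have hrel : f (Wy K) * f (Wx K) = f (Wx K) * f (Wy K) + 1 := by
    rw [← map_mul, wy_wx, map_add, map_mul, map_one]
  have hT := w_repr' (f (Wy K)) {(0, 0), (0, 1)} (by
    intro m hm
    simp only [Finset.mem_insert, Finset.mem_singleton, not_or] at hm
    exact spec_main _ _ hrel hσ m hm.1 hm.2)
  rw [Finset.sum_pair (by simp)] at hT
  generalize cf (0, 0) (f (Wy K)) = c at hT
  generalize cf (0, 1) (f (Wy K)) = b at hT
  have hT2 : f (Wy K) = c • 1 + b • Wy K := by rw [hT]; simp [mon]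
  have hb : b ≠ 0 := by
    rintro rfl
    rw [hT2] at hrel
    rw [zero_smul, add_zero, smul_mul_assoc, mul_smul_comm, one_mul, mul_one] at hrel
    exact one_ne_zero (left_eq_add.1 hrel)
  have hrel2 := hrel
  rw [hT2] at hrel2
  have hD := ab_aux b hb c _ _ _ (wy_wx K) hrel2
  have hY : Wy K ∈ f.range := by
    have h1 : b • Wy K ∈ f.range := by
      have : b • Wy K = f (Wy K) - c • 1 := by rw [hT2, add_sub_cancel_left]
      rw [this]
      exact sub_mem ⟨_, rfl⟩ (f.range.smul_mem f.range.one_mem c)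
    have := f.range.smul_mem h1 b⁻¹
    rwa [smul_smul, inv_mul_cancel₀ hb, one_smul] at this
  have hDm : f (Wx K) - b⁻¹ • Wx K ∈ f.range := by
    generalize f (Wx K) - b⁻¹ • Wx K = D at hD
    obtain ⟨F, hF, e⟩ := w_repr D
    rw [e]
    apply sum_mem
    rintro ⟨i, j⟩ _
    rcases i with _ | i
    · apply f.range.smul_mem
      have : mon K (0, j) = Wy K ^ j := by simp [mon]
      rw [this]
      exact pow_mem hY j
    · have h1 := cf_ady D (i, j)
      rw [hD, map_zero] at h1
      have h2 : cf (i + 1, j) D = 0 := by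
        rcases mul_eq_zero.1 h1.symm with h | h
        · exact absurd h (by exact_mod_cast Nat.succ_ne_zero i)
        · exact h
      rw [h2, zero_smul]
      exact zero_mem _
  have hX : Wx K ∈ f.range := by
    have h1 : b⁻¹ • Wx K ∈ f.range := by
      have : b⁻¹ • Wx K = f (Wx K) - (f (Wx K) - b⁻¹ • Wx K) := by rw [sub_sub_cancel]
      rw [this]
      exact sub_mem ⟨_, rfl⟩ hDm
    have := f.range.smul_mem h1 b
    rwa [smul_smul, mul_inv_cancel₀ hb, one_smul] at this
  intro a
  exact w_adjoin f.range hX hY a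

section Th
variable {K A : Type} [Field K] [CharZero K] [Ring A] [Algebra K A]

theorem th_rel (X Y : A) (h : Y * X = X * Y + 1) :
    ((2 : K)⁻¹ • (Y - X)) * (X + Y) = (X + Y) * ((2 : K)⁻¹ • (Y - X)) + 1 := by
  rw [smul_mul_assoc, mul_smul_comm]
  have : (Y - X) * (X + Y) = (X + Y) * (Y - X) + (2 : K) • 1 := by
    rw [two_smul]
    simp only [sub_mul, mul_add, mul_sub, add_mul, h]
    abel
  rw [this, smul_add, smul_smul, inv_mul_cancel₀ two_ne_zero, one_smul]

theorem thi_rel (X Y : A) (h : Y * X = X * Y + 1) :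
    ((2 : K)⁻¹ • X + Y) * ((2 : K)⁻¹ • X - Y) = ((2 : K)⁻¹ • X - Y) * ((2 : K)⁻¹ • X + Y) + 1 := by
  simp only [sub_mul, mul_add, mul_sub, add_mul, smul_mul_assoc, mul_smul_comm, h, smul_add, smul_sub]
  have : (1 : A) = (2 : K)⁻¹ • 1 + (2 : K)⁻¹ • 1 := by
    rw [← add_smul]; norm_num
  generalize (2 : K)⁻¹ • (1 : A) = e at *
  rw [this]
  abel

theorem th1 (X Y : A) : (2 : K)⁻¹ • (X + Y) - (2 : K)⁻¹ • (Y - X) = X := by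
  rw [← smul_sub]
  have : X + Y - (Y - X) = (2 : K) • X := by rw [two_smul]; abel
  rw [this, smul_smul, inv_mul_cancel₀ two_ne_zero, one_smul]

theorem th2 (X Y : A) : (2 : K)⁻¹ • (X + Y) + (2 : K)⁻¹ • (Y - X) = Y := by
  rw [← smul_add]
  have : X + Y + (Y - X) = (2 : K) • Y := by rw [two_smul]; abel
  rw [this, smul_smul, inv_mul_cancel₀ two_ne_zero, one_smul]

theorem th3 (X Y : A) : ((2 : K)⁻¹ • X - Y) + ((2 : K)⁻¹ • X + Y) = X := by
  have : ((2 : K)⁻¹ • X - Y) + ((2 : K)⁻¹ • X + Y) = (2 : K) • (2 : K)⁻¹ • X := by rw [two_smul]; abel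
  rw [this, smul_smul, mul_inv_cancel₀ two_ne_zero, one_smul]

theorem th4 (X Y : A) : (2 : K)⁻¹ • (((2 : K)⁻¹ • X + Y) - ((2 : K)⁻¹ • X - Y)) = Y := by
  have : ((2 : K)⁻¹ • X + Y) - ((2 : K)⁻¹ • X - Y) = (2 : K) • Y := by rw [two_smul]; abel
  rw [this, smul_smul, inv_mul_cancel₀ two_ne_zero, one_smul]

theorem th5 (X Y : A) : (2 : K)⁻¹ • (X - Y) = -((2 : K)⁻¹ • (Y - X)) := by
  rw [← smul_neg, neg_sub]
end Th

variable (K : Type) [Field K] [CharZero K]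

def thF : Weyl K →ₐ[K] Weyl K :=
  wLift (Wx K + Wy K) ((2 : K)⁻¹ • (Wy K - Wx K)) (th_rel _ _ (wy_wx K))

def thI : Weyl K →ₐ[K] Weyl K :=
  wLift ((2 : K)⁻¹ • Wx K - Wy K) ((2 : K)⁻¹ • Wx K + Wy K) (thi_rel _ _ (wy_wx K))

theorem thF_x : thF K (Wx K) = Wx K + Wy K := wLift_x ..
theorem thF_y : thF K (Wy K) = (2 : K)⁻¹ • (Wy K - Wx K) := wLift_y ..
theorem thI_x : thI K (Wx K) = (2 : K)⁻¹ • Wx K - Wy K := wLift_x ..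
theorem thI_y : thI K (Wy K) = (2 : K)⁻¹ • Wx K + Wy K := wLift_y ..

def th : Weyl K ≃ₐ[K] Weyl K :=
  AlgEquiv.ofAlgHom (thF K) (thI K)
    (by
      apply w_hom_ext
      · simp only [AlgHom.comp_apply, AlgHom.id_apply, thI_x, map_sub, map_smul, thF_x, thF_y]
        exact th1 (K := K) _ _
      · simp only [AlgHom.comp_apply, AlgHom.id_apply, thI_y, map_add, map_smul, thF_x, thF_y]
        exact th2 (K := K) _ _)
    (by
      apply w_hom_ext
      · simp only [AlgHom.comp_apply, AlgHom.id_apply, thF_x, map_add, thI_x, thI_y]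
        exact th3 (K := K) _ _
      · simp only [AlgHom.comp_apply, AlgHom.id_apply, thF_y, map_sub, map_smul, thI_x, thI_y]
        exact th4 (K := K) _ _)

variable {K}

def toHom (f : Weyl K → Weyl K) (h : IsAlgEndo K f) : Weyl K →ₐ[K] Weyl K :=
  AlgHom.ofLinearMap { toFun := f, map_add' := h.1, map_smul' := h.2.1 } h.2.2.2 h.2.2.1

def toAnti (f : Weyl K → Weyl K) (h : IsAntiEndo K f) : Weyl K →ₐ[K] (Weyl K)ᵐᵒᵖ :=
  AlgHom.ofLinearMap
    { toFun := fun a => MulOpposite.op (f a)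
      map_add' := fun a b => by rw [h.1]; rfl
      map_smul' := fun c a => by rw [h.2.1]; rfl }
    (by
      change MulOpposite.op (f 1) = 1
      rw [h.2.2.2]; rfl)
    (fun a b => by
      change MulOpposite.op (f (a * b)) = MulOpposite.op (f a) * MulOpposite.op (f b)
      rw [h.2.2.1]; rfl)

theorem th_al (α : Weyl K → Weyl K) (hα : IsExchange K α) (a : Weyl K) :
    α (th K a) = th K (wSig K a).unop := by
  have key : (toAnti α hα.1.1.1).comp (thF K) = (AlgHom.op (thF K)).comp (wSig K) := by
    have hadd := hα.1.1.1.1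
    have hsm := hα.1.1.1.2.1
    have hsub : ∀ a b, α (a - b) = α a - α b := fun a b => by
      rw [eq_sub_iff_add_eq, ← hadd, sub_add_cancel]
    apply w_hom_ext
    · apply MulOpposite.unop_injective
      have h1 : ((AlgHom.op (thF K)).comp (wSig K) (Wx K)).unop = thF K (Wx K) := by
        simp [wSig]
      rw [h1]
      change α (thF K (Wx K)) = _
      rw [thF_x, hadd, hα.2.1, hα.2.2, add_comm]
    · apply MulOpposite.unop_injective
      have h1 : ((AlgHom.op (thF K)).comp (wSig K) (Wy K)).unop = - thF K (Wy K) := by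
        rw [← map_neg]
        simp [wSig]
      rw [h1]
      change α (thF K (Wy K)) = _
      rw [thF_y, hsm, hsub, hα.2.1, hα.2.2]
      exact th5 _ _
  exact congrArg MulOpposite.unop (DFunLike.congr_fun key a)

theorem conj_equiv (α : Weyl K → Weyl K) (hα : IsExchange K α) (γ : Weyl K → Weyl K)
    (h : ConjToAlpha K α γ) : ∃ G : Weyl K ≃ₐ[K] Weyl K, ∀ a, G (γ a) = α (G a) := by
  obtain ⟨g, hg, rfl⟩ := h
  rcases hg with hg | hg
  · refine ⟨AlgEquiv.ofBijective (toHom g hg.1) hg.2, fun a => ?_⟩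
    change g (Function.invFun g (α (g a))) = α (g a)
    exact Function.rightInverse_invFun hg.2.2 _
  · have hA := hα.1.1.1
    have hG := hg.1
    have he : IsAlgEndo K (α ∘ g) := by
      refine ⟨fun a b => ?_, fun c a => ?_, fun a b => ?_, ?_⟩
      · simp only [Function.comp, hG.1, hA.1]
      · simp only [Function.comp, hG.2.1, hA.2.1]
      · simp only [Function.comp, hG.2.2.1, hA.2.2.1]
      · simp only [Function.comp, hG.2.2.2, hA.2.2.2]
    refine ⟨AlgEquiv.ofBijective (toHom (α ∘ g) he) (hα.1.1.2.comp hg.2), fun a => ?_⟩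
    change α (g (Function.invFun g (α (g a)))) = α (α (g a))
    rw [Function.rightInverse_invFun hg.2.2 _]

theorem final_main (α : Weyl K → Weyl K) (hα : IsExchange K α)
    (hB : ∀ γ : Weyl K → Weyl K, IsInvolutionOn K γ → ConjToAlpha K α γ)
    (f γ δ : Weyl K → Weyl K) (hf : IsAlgEndo K f)
    (hγ : IsInvolutionOn K γ) (hδ : IsInvolutionOn K δ)
    (hfγδ : f ∘ γ = δ ∘ f) :
    IsAlgAuto K f := by
  obtain ⟨G, hG⟩ := conj_equiv α hα γ (hB γ hγ)
  obtain ⟨H, hH⟩ := conj_equiv α hα δ (hB δ hδ)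
  let P : Weyl K ≃ₐ[K] Weyl K := (th K).trans G.symm
  let Q : Weyl K ≃ₐ[K] Weyl K := H.trans (th K).symm
  have hP : ∀ a, γ (P a) = P (wSig K a).unop := by
    intro a
    change γ (G.symm (th K a)) = G.symm (th K (wSig K a).unop)
    rw [← th_al α hα, AlgEquiv.eq_symm_apply, hG, AlgEquiv.apply_symm_apply]
  have hQ : ∀ a, Q (δ a) = (wSig K (Q a)).unop := by
    intro a
    change (th K).symm (H (δ a)) = (wSig K ((th K).symm (H a))).unop
    rw [AlgEquiv.symm_apply_eq, ← th_al α hα, hH, AlgEquiv.apply_symm_apply]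
  let f2 : Weyl K →ₐ[K] Weyl K := (Q : Weyl K →ₐ[K] Weyl K).comp ((toHom f hf).comp (P : Weyl K →ₐ[K] Weyl K))
  have hf2 : ∀ a, f2 a = Q (f (P a)) := fun a => rfl
  have hs : (wSig K (f2 (Wy K))).unop = - f2 (Wy K) := by
    rw [hf2, ← hQ]
    have : δ (f (P (Wy K))) = f (γ (P (Wy K))) := (congrFun hfγδ _).symm
    rw [this, hP, ← hf2, ← hf2]
    have : (wSig K (Wy K)).unop = - Wy K := by simp [wSig]
    rw [this, map_neg]
  have hbij : Function.Bijective f2 := ⟨f_inj f2, f_surj f2 hs⟩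
  refine ⟨hf, ?_⟩
  have : f = Q.symm ∘ f2 ∘ P.symm := by
    funext a
    simp only [Function.comp, hf2, AlgEquiv.apply_symm_apply, AlgEquiv.symm_apply_apply]
  rw [this]
  exact Q.symm.bijective.comp (hbij.comp P.symm.bijective)

end Final

/-- involutive Dixmier conjecture, second version: assuming every involution
on `A₁` is conjugate to `α`, an endomorphism intertwining two involutions is an
automorphism. -/
theorem stmt_9 {K : Type} [Field K] [CharZero K]
    (α : Weyl K → Weyl K) (hα : IsExchange K α)
    (hB : ∀ γ : Weyl K → Weyl K, IsInvolutionOn K γ → ConjToAlpha K α γ)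
    (f γ δ : Weyl K → Weyl K) (hf : IsAlgEndo K f)
    (hγ : IsInvolutionOn K γ) (hδ : IsInvolutionOn K δ)
    (hfγδ : f ∘ γ = δ ∘ f) :
    IsAlgAuto K f := by
  exact final_main α hα hB f γ δ hf hγ hδ hfγδ
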